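/- arXiv:2310.10812 — 4 statements merged into one kernel-verified Lean document; each statement's English description precedes it below -/
import Mathlib

section
/- Let q be a real number with |q| < 1. Then ∑_{i ≥ 1, j ≥ 1} q^{i+j} / ((1-q^i)(1-q^j)(1-q^{i+j})) = Z(3) - ∑_{n ≥ 1} n q^n/(1-q^n)^2. -/
open scoped BigOperators

/-- Okounkov's `Z(2) = ∑_{n ≥ 1} qⁿ/(1-qⁿ)²`. -/
noncomputable def Z2 (q : ℝ) : ℝ := ∑' n : ℕ+, q ^ (n : ℕ) / (1 - q ^ (n : ℕ)) ^ 2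

/-- Okounkov's `Z(3) = ∑_{n ≥ 1} qⁿ(qⁿ+1)/(1-qⁿ)³`. -/
noncomputable def Z3 (q : ℝ) : ℝ :=
  ∑' n : ℕ+, q ^ (n : ℕ) * (q ^ (n : ℕ) + 1) / (1 - q ^ (n : ℕ)) ^ 3

/-- Okounkov's `Z(4) = ∑_{n ≥ 1} q²ⁿ/(1-qⁿ)⁴`. -/
noncomputable def Z4 (q : ℝ) : ℝ := ∑' n : ℕ+, q ^ (2 * (n : ℕ)) / (1 - q ^ (n : ℕ)) ^ 4

/-- The positive quadrant is the disjoint union of its diagonal and two open cones, each a copy of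
the quadrant. -/
noncomputable def pnatProdEquiv : ℕ+ ⊕ (ℕ+ × ℕ+) ⊕ (ℕ+ × ℕ+) ≃ ℕ+ × ℕ+ :=
  Equiv.ofBijective
    (Sum.elim (fun c ↦ (c, c)) (Sum.elim (fun p ↦ (p.1, p.2 + p.1)) fun p ↦ (p.2 + p.1, p.1))) <| by
    constructor
    · rintro (c | ⟨a, b⟩ | ⟨a, b⟩) (c' | ⟨a', b'⟩ | ⟨a', b'⟩) h <;>
        simp [← PNat.coe_inj] at h ⊢ <;>
        first
        | omega
        | (have := a.pos; have := b.pos; have := a'.pos; have := b'.pos; omega)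
        | (have := a.pos; have := b.pos; omega)
        | (have := a'.pos; have := b'.pos; omega)
    · rintro ⟨a, b⟩
      rcases lt_trichotomy a b with h | rfl | h
      · exact ⟨.inr (.inl (a, b - a)), by simp [PNat.sub_add_of_lt h]⟩
      · exact ⟨.inl a, rfl⟩
      · exact ⟨.inr (.inr (b, a - b)), by simp [PNat.sub_add_of_lt h]⟩

lemma hasSum_prod_of_diag {f : ℕ+ × ℕ+ → ℝ} {d l u : ℝ} (hd : HasSum (fun c ↦ f (c, c)) d)
    (hl : HasSum (fun p : ℕ+ × ℕ+ ↦ f (p.1, p.2 + p.1)) l)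
    (hu : HasSum (fun p : ℕ+ × ℕ+ ↦ f (p.2 + p.1, p.1)) u) : HasSum f (d + (l + u)) :=
  pnatProdEquiv.hasSum_iff.mp (HasSum.sum hd (HasSum.sum hl hu))

lemma summable_lower {f : ℕ+ × ℕ+ → ℝ} (hf : Summable f) :
    Summable fun p : ℕ+ × ℕ+ ↦ f (p.1, p.2 + p.1) :=
  (pnatProdEquiv.summable_iff.mpr hf).comp_injective (Sum.inr_injective.comp Sum.inl_injective)

lemma summable_upper {f : ℕ+ × ℕ+ → ℝ} (hf : Summable f) :
    Summable fun p : ℕ+ × ℕ+ ↦ f (p.2 + p.1, p.1) :=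
  (pnatProdEquiv.summable_iff.mpr hf).comp_injective (Sum.inr_injective.comp Sum.inr_injective)

lemma summable_diag {f : ℕ+ × ℕ+ → ℝ} (hf : Summable f) : Summable fun c ↦ f (c, c) :=
  (pnatProdEquiv.summable_iff.mpr hf).comp_injective Sum.inl_injective

/-- Summing a function of `a + b` over the quadrant counts each `n` with multiplicity `n - 1`. -/
lemma hasSum_pnat_of_add {h : ℕ → ℝ} {s : ℝ}
    (hs : HasSum (fun p : ℕ+ × ℕ+ ↦ h (p.1 + p.2)) s) :
    HasSum (fun n : ℕ+ ↦ ((n : ℝ) - 1) * h n) s := by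
  have e : HasSum (fun p : ℕ × ℕ ↦ h (p.1 + p.2 + 2)) s := by
    rw [← (Equiv.pnatEquivNat.prodCongr Equiv.pnatEquivNat).hasSum_iff]
    convert hs using 3 with p
    have := p.1.pos
    have := p.2.pos
    simp [PNat.natPred]
    congr 1
    omega
  rw [← Finset.HasAntidiagonal.sigmaAntidiagonalEquivProd.hasSum_iff] at e
  have e2 := e.sigma fun n ↦ hasSum_fintype _
  rw [hasSum_pnat_iff_hasSum_succ (f := fun n : ℕ ↦ ((n : ℝ) - 1) * h n)]
  have e3 : (fun n : ℕ ↦ (((n + 1 + 1 : ℕ) : ℝ) - 1) * h (n + 1 + 1)) = fun n ↦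
      ∑ b ∈ (Finset.HasAntidiagonal.antidiagonal n).attach, h (b.1.1 + b.1.2 + 2) := by
    ext n
    rw [Finset.sum_attach (Finset.HasAntidiagonal.antidiagonal n) (fun p ↦ h (p.1 + p.2 + 2)),
      Finset.sum_congr rfl (g := fun _ ↦ h (n + 2))]
    · simp [add_assoc]
      left
      ring
    · intro p hp
      rw [Finset.HasAntidiagonal.mem_antidiagonal.mp hp]
  have e4 := (hasSum_nat_add_iff (f := fun n : ℕ ↦ (((n + 1 : ℕ) : ℝ) - 1) * h (n + 1)) 1).mp
    (e3 ▸ e2)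
  simpa using e4

lemma hasSum_pnat_geometric {x : ℝ} (hx : |x| < 1) :
    HasSum (fun n : ℕ+ ↦ x ^ (n : ℕ)) (x / (1 - x)) := by
  rw [hasSum_pnat_iff (f := fun n : ℕ ↦ x ^ n)]
  convert! hasSum_geometric_of_abs_lt_one hx using 1
  have : 1 - x ≠ 0 := by linarith [(abs_lt.mp hx).2]
  simp
  field_simp
  ring

lemma hasSum_pnat_mul_geometric {x : ℝ} (hx : |x| < 1) :
    HasSum (fun n : ℕ+ ↦ (n : ℝ) * x ^ (n : ℕ)) (x / (1 - x) ^ 2) := by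
  rw [hasSum_pnat_iff (f := fun n : ℕ ↦ (n : ℝ) * x ^ n)]
  simpa using hasSum_coe_mul_geometric_of_norm_lt_one (r := x) hx

lemma hasSum_pnat_sq_mul_geometric {x : ℝ} (hx : |x| < 1) :
    HasSum (fun n : ℕ+ ↦ (n : ℝ) ^ 2 * x ^ (n : ℕ)) (x * (x + 1) / (1 - x) ^ 3) := by
  rw [hasSum_pnat_iff (f := fun n : ℕ ↦ (n : ℝ) ^ 2 * x ^ n)]
  have h2 := (hasSum_choose_mul_geometric_of_norm_lt_one 2 (r := x) hx).mul_left 2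
  have h1 := (hasSum_coe_mul_geometric_of_norm_lt_one (r := x) hx).mul_left 3
  have h0 := (hasSum_geometric_of_abs_lt_one hx).mul_left 2
  convert (h2.sub h1).sub h0 using 1
  · ext n
    rw [Nat.cast_choose_two]
    push_cast
    ring
  · have : 1 - x ≠ 0 := by linarith [(abs_lt.mp hx).2]
    simp
    field_simp
    ring

lemma hasSum_pnat_prod_mul {f g : ℕ+ → ℝ} {s t : ℝ} (hf : HasSum f s) (hg : HasSum g t) :
    HasSum (fun p : ℕ+ × ℕ+ ↦ f p.1 * g p.2) (s * t) :=
  hf.mul hg (summable_mul_of_summable_norm hf.summable.norm hg.summable.norm)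

lemma hasSum_min_mul_geometric {x y : ℝ} (hx : |x| < 1) (hy : |y| < 1) :
    HasSum (fun p : ℕ+ × ℕ+ ↦ min (p.1 : ℝ) p.2 * (x ^ (p.1 : ℕ) * y ^ (p.2 : ℕ)))
      (x * y / ((1 - x) * (1 - y) * (1 - x * y))) := by
  have hxy : |x * y| < 1 := by
    rw [abs_mul]
    exact mul_lt_one_of_nonneg_of_lt_one_left (abs_nonneg x) hx hy.le
  have hd := hasSum_pnat_mul_geometric hxy
  have hl := hasSum_pnat_prod_mul hd (hasSum_pnat_geometric hy)
  have hu := hasSum_pnat_prod_mul hd (hasSum_pnat_geometric hx)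
  convert hasSum_prod_of_diag (d := x * y / (1 - x * y) ^ 2) ?_ ?_ ?_ using 1
  rotate_left
  · exact x * y / (1 - x * y) ^ 2 * (y / (1 - y))
  · exact x * y / (1 - x * y) ^ 2 * (x / (1 - x))
  · simpa [mul_pow] using hd
  · convert hl using 2 with p
    rw [min_eq_left (by simp), PNat.add_coe]
    ring
  · convert hu using 2 with p
    rw [min_eq_right (by simp), PNat.add_coe]
    ring
  · have h1 : 1 - x ≠ 0 := by linarith [(abs_lt.mp hx).2]
    have h2 : 1 - y ≠ 0 := by linarith [(abs_lt.mp hy).2]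
    have h3 : 1 - x * y ≠ 0 := by linarith [(abs_lt.mp hxy).2]
    field_simp
    ring

lemma abs_pow_pnat_lt_one {q : ℝ} (hq : |q| < 1) (n : ℕ+) : |q ^ (n : ℕ)| < 1 := by
  rw [abs_pow]
  exact pow_lt_one₀ (abs_nonneg q) hq n.ne_zero

lemma one_sub_pow_pnat_ne_zero {q : ℝ} (hq : |q| < 1) (n : ℕ+) : 1 - q ^ (n : ℕ) ≠ 0 := by
  linarith [(abs_lt.mp (abs_pow_pnat_lt_one hq n)).2]

lemma lambert_mul_lambert {q : ℝ} (hq : |q| < 1) (b c : ℕ+) :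
    q ^ (b : ℕ) / (1 - q ^ (b : ℕ)) * (q ^ (c : ℕ) / (1 - q ^ (c : ℕ))) =
      q ^ ((b : ℕ) + c) / (1 - q ^ ((b : ℕ) + c)) *
        (1 + q ^ (b : ℕ) / (1 - q ^ (b : ℕ)) + q ^ (c : ℕ) / (1 - q ^ (c : ℕ))) := by
  have h1 := one_sub_pow_pnat_ne_zero hq b
  have h2 := one_sub_pow_pnat_ne_zero hq c
  have h3 := one_sub_pow_pnat_ne_zero hq (b + c)
  simp only [PNat.add_coe, pow_add] at h3 ⊢
  field_simp
  ring

lemma summable_pnat_pow_mul_pow_mul {q : ℝ} (hq : |q| < 1) (k : ℕ) :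
    Summable fun p : ℕ+ × ℕ+ ↦ (p.1 : ℝ) ^ k * q ^ ((p.1 : ℕ) * p.2) := by
  have h := (summable_prod_mul_pow k (r := q) hq).prod_symm
  simpa only [Prod.swap, mul_comm] using h

lemma summable_pow_mul_lambert {q : ℝ} (hq : |q| < 1) (k : ℕ) :
    Summable fun n : ℕ+ ↦ (n : ℝ) ^ k * (q ^ (n : ℕ) / (1 - q ^ (n : ℕ))) := by
  refine ((summable_pnat_pow_mul_pow_mul hq k).hasSum.prod_fiberwise fun n ↦ ?_).summable
  simpa only [← pow_mul] using
    (hasSum_pnat_geometric (abs_pow_pnat_lt_one hq n)).mul_left ((n : ℝ) ^ k)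

lemma summable_min_mul_pow {q : ℝ} (hq : |q| < 1) :
    Summable fun p : (ℕ+ × ℕ+) × (ℕ+ × ℕ+) ↦ min (p.2.1 : ℝ) p.2.2 *
      ((q ^ (p.1.1 : ℕ)) ^ (p.2.1 : ℕ) * (q ^ (p.1.2 : ℕ)) ^ (p.2.2 : ℕ)) := by
  have h := (summable_pnat_pow_mul_pow_mul hq 1).prod_symm.abs
  have h2 := h.mul_of_nonneg h (fun _ ↦ abs_nonneg _) (fun _ ↦ abs_nonneg _)
  rw [← (Equiv.prodProdProdComm ℕ+ ℕ+ ℕ+ ℕ+).summable_iff] at h2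
  refine Summable.of_norm_bounded h2 ?_
  rintro ⟨⟨i, j⟩, r, s⟩
  have hs : (1 : ℝ) ≤ s := by exact_mod_cast s.pos
  have hm : |min (r : ℝ) s| ≤ r * s := by
    rw [abs_of_nonneg (by positivity)]
    exact (min_le_left _ _).trans (le_mul_of_one_le_right (by positivity) hs)
  simp only [Real.norm_eq_abs, abs_mul, abs_pow, Function.comp, Equiv.prodProdProdComm_apply,
    Prod.swap, Nat.abs_cast, ← pow_mul, pow_one]
  calc _ ≤ ((r : ℝ) * s) * (|q| ^ ((i : ℕ) * r) * |q| ^ ((j : ℕ) * s)) := by gcongr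
    _ = _ := by ring

/-- The double series is the sum of `min r s` against a product of two Lambert terms. -/
lemma tsum_tsum_eq_tsum_min {q : ℝ} (hq : |q| < 1) :
    (∑' i : ℕ+, ∑' j : ℕ+, q ^ ((i : ℕ) + (j : ℕ)) /
      ((1 - q ^ (i : ℕ)) * (1 - q ^ (j : ℕ)) * (1 - q ^ ((i : ℕ) + (j : ℕ))))) =
      ∑' p : ℕ+ × ℕ+, min (p.1 : ℝ) p.2 *
        (q ^ (p.1 : ℕ) / (1 - q ^ (p.1 : ℕ)) * (q ^ (p.2 : ℕ) / (1 - q ^ (p.2 : ℕ)))) := by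
  obtain ⟨S, hK⟩ := summable_min_mul_pow hq
  have h1 : HasSum (fun p : ℕ+ × ℕ+ ↦ q ^ (p.1 : ℕ) * q ^ (p.2 : ℕ) /
      ((1 - q ^ (p.1 : ℕ)) * (1 - q ^ (p.2 : ℕ)) * (1 - q ^ (p.1 : ℕ) * q ^ (p.2 : ℕ)))) S := by
    refine hK.prod_fiberwise fun p ↦ ?_
    simpa only using
      hasSum_min_mul_geometric (abs_pow_pnat_lt_one hq p.1) (abs_pow_pnat_lt_one hq p.2)
  have h2 : HasSum (fun p : ℕ+ × ℕ+ ↦ min (p.1 : ℝ) p.2 *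
      (q ^ (p.1 : ℕ) / (1 - q ^ (p.1 : ℕ)) * (q ^ (p.2 : ℕ) / (1 - q ^ (p.2 : ℕ))))) S := by
    refine ((Equiv.prodComm (ℕ+ × ℕ+) (ℕ+ × ℕ+)).hasSum_iff.mpr hK).prod_fiberwise fun p ↦ ?_
    have h := (hasSum_pnat_prod_mul (hasSum_pnat_geometric (abs_pow_pnat_lt_one hq p.1))
        (hasSum_pnat_geometric (abs_pow_pnat_lt_one hq p.2))).mul_left (min (p.1 : ℝ) p.2)
    simp only [← pow_mul, Function.comp, Equiv.prodComm_apply, Prod.swap] at h ⊢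
    simpa only [mul_comm] using h
  rw [h2.tsum_eq, ← h1.tsum_eq, h1.summable.tsum_prod]
  simp only [pow_add]

/-- Split `∑ a Xₐ X_b` and `∑ min a b Xₐ X_b` along the diagonal and expand the former using the
functional equation of `X`. -/
lemma tsum_min_mul_eq {X : ℕ → ℝ}
    (hX : ∀ b c : ℕ+, X b * X c = X ((b : ℕ) + c) * (1 + X b + X c))
    (h0 : Summable fun n : ℕ+ ↦ X n) (h1 : Summable fun n : ℕ+ ↦ (n : ℝ) * X n) :
    ∑' p : ℕ+ × ℕ+, min (p.1 : ℝ) p.2 * (X p.1 * X p.2) =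
      (∑' n : ℕ+, (n : ℝ) ^ 2 * X n) - ∑' n : ℕ+, (n : ℝ) * (X n + X n ^ 2) := by
  have h := hasSum_pnat_prod_mul h1.hasSum h0.hasSum
  have hT := h.summable
  obtain ⟨P, hP⟩ := summable_diag hT
  obtain ⟨G, hG⟩ := summable_lower hT
  obtain ⟨U, hU⟩ := summable_upper hT
  have hTs := hasSum_prod_of_diag (f := fun p ↦ (p.1 : ℝ) * X p.1 * X p.2) hP hG hU
  have hH := (Equiv.prodComm ℕ+ ℕ+).hasSum_iff.mpr (hU.sub hG)
  have hE : HasSum (fun p : ℕ+ × ℕ+ ↦ (p.1 : ℝ) * X (p.1 + p.2 : ℕ)) (P + G) := by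
    convert! (hTs.sub hG).sub hH using 1
    · ext p
      simp only [Function.comp, Equiv.prodComm_apply, Prod.swap, PNat.add_coe]
      rw [mul_assoc, hX, add_comm (p.2 : ℕ)]
      push_cast
      ring
    · ring
  have hN : HasSum (fun n : ℕ+ ↦ ((n : ℝ) - 1) * (n * X n)) ((P + G) + (P + G)) := by
    refine hasSum_pnat_of_add (h := fun n ↦ n * X n) ?_
    convert hE.add ((Equiv.prodComm ℕ+ ℕ+).hasSum_iff.mpr hE) using 2 with p
    simp only [Function.comp, Equiv.prodComm_apply, Prod.swap, add_comm (p.2 : ℕ)]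
    push_cast
    ring
  obtain ⟨M, hM⟩ := h1
  have hF : HasSum (fun p : ℕ+ × ℕ+ ↦ min (p.1 : ℝ) p.2 * (X p.1 * X p.2))
      (P + (G + G)) := by
    refine hasSum_prod_of_diag ?_ ?_ ?_
    · simpa only [min_self, mul_assoc] using hP
    · convert hG using 2 with p
      rw [min_eq_left (by simp), mul_assoc]
    · convert hG using 2 with p
      rw [min_eq_right (by simp)]
      ring
  have hS : HasSum (fun n : ℕ+ ↦ (n : ℝ) ^ 2 * X n) (P + G + (P + G) + M) := by
    convert hN.add hM using 2 with n
    ring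
  have hD : HasSum (fun n : ℕ+ ↦ (n : ℝ) * (X n + X n ^ 2)) (P + M) := by
    convert hP.add hM using 2 with n
    ring
  rw [hF.tsum_eq, hS.tsum_eq, hD.tsum_eq]
  ring

theorem double_sum_eq_Z3_sub (q : ℝ) (hq : |q| < 1) :
    (∑' i : ℕ+, ∑' j : ℕ+, q ^ ((i : ℕ) + (j : ℕ)) / ((1 - q ^ (i : ℕ)) * (1 - q ^ (j : ℕ)) * (1 - q ^ ((i : ℕ) + (j : ℕ)))))
      = Z3 q - (∑' n : ℕ+, (n : ℝ) * q ^ (n : ℕ) / (1 - q ^ (n : ℕ)) ^ 2) := by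
  have h0 := summable_pow_mul_lambert hq 0
  have h1 := summable_pow_mul_lambert hq 1
  simp only [pow_zero, one_mul, pow_one] at h0 h1
  rw [tsum_tsum_eq_tsum_min hq,
    tsum_min_mul_eq (X := fun n ↦ q ^ n / (1 - q ^ n)) (lambert_mul_lambert hq) h0 h1]
  congr 1
  swap
  · refine tsum_congr fun n ↦ ?_
    have := one_sub_pow_pnat_ne_zero hq n
    field_simp
    ring
  obtain ⟨S, hS⟩ := summable_pnat_pow_mul_pow_mul hq 2
  have h1 : HasSum (fun n : ℕ+ ↦ q ^ (n : ℕ) * (q ^ (n : ℕ) + 1) / (1 - q ^ (n : ℕ)) ^ 3) S := by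
    refine ((Equiv.prodComm ℕ+ ℕ+).hasSum_iff.mpr hS).prod_fiberwise fun n ↦ ?_
    simpa [← pow_mul, mul_comm] using hasSum_pnat_sq_mul_geometric (abs_pow_pnat_lt_one hq n)
  have h2 : HasSum (fun n : ℕ+ ↦ (n : ℝ) ^ 2 * (q ^ (n : ℕ) / (1 - q ^ (n : ℕ)))) S := by
    refine hS.prod_fiberwise fun n ↦ ?_
    simpa only [← pow_mul] using
      (hasSum_pnat_geometric (abs_pow_pnat_lt_one hq n)).mul_left ((n : ℝ) ^ 2)
  rw [Z3, h1.tsum_eq, h2.tsum_eq]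
end

section
/- Let q be a real number with |q| < 1. Then ∑_{i ≥ 1, j ≥ 1} (i+j) q^{i+j} / ((1-q^i)(1-q^j)(1-q^{i+j})) = 2 ∑_{n > m ≥ 1} n q^n / ((1-q^n)^2 (1-q^m)) - ∑_{n ≥ 1} n(n-1) q^n/(1-q^n)^2. -/
open scoped BigOperators

/-- Reindexing a double sum over `(i, j)` by `(n, m) = (i + j, i)`. -/
theorem tsum_add_eq_tsum_lt (G : ℕ+ → ℕ+ → ℝ)
    (hG : Summable fun p : ℕ+ × ℕ+ => G p.1 (p.1 + p.2)) :
    ∑' p : ℕ+ × ℕ+, G p.1 (p.1 + p.2)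
      = ∑' n : ℕ+, ∑' m : ℕ+, if (m : ℕ) < (n : ℕ) then G m n else 0 := by
  let F : ℕ+ × ℕ+ → ℝ := fun p => if (p.2 : ℕ) < (p.1 : ℕ) then G p.2 p.1 else 0
  let φ : ℕ+ × ℕ+ → ℕ+ × ℕ+ := fun p => (p.1 + p.2, p.1)
  have hφ : Function.Injective φ := by
    rintro ⟨a, b⟩ ⟨c, d⟩ h
    simp only [φ, Prod.mk.injEq] at h
    obtain ⟨h1, rfl⟩ := h
    simpa using h1
  have hsupp : ∀ p, p ∉ Set.range φ → F p = 0 := by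
    rintro ⟨n, m⟩ hp
    refine if_neg fun h => hp ⟨(m, n - m), ?_⟩
    have h' : m < n := h
    simp [φ, PNat.add_sub_of_lt h']
  have hcomp : F ∘ φ = fun p => G p.1 (p.1 + p.2) := by
    funext p
    exact if_pos (by simp only [φ, PNat.add_coe]; have := p.2.pos; omega)
  have hs : Summable F := by
    rw [← hφ.summable_iff hsupp, hcomp]
    exact hG
  rw [← hs.tsum_prod (f := F), ← hφ.tsum_eq (f := F)]
  · exact tsum_congr fun p => (congrFun hcomp p).symm
  · intro p hp
    by_contra h
    exact hp (hsupp p h)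

theorem summable_add_mul_pow_add_mul {q : ℝ} (hq : |q| < 1) (c : ℕ+ × ℕ+ → ℝ) (C : ℝ)
    (hc : ∀ p, |c p| ≤ C) :
    Summable fun p : ℕ+ × ℕ+ =>
      ((p.1 : ℝ) + (p.2 : ℝ)) * q ^ ((p.1 : ℕ) + (p.2 : ℕ)) * c p := by
  have h0 : Summable fun n : ℕ+ => |q| ^ (n : ℕ) :=
    (summable_geometric_of_lt_one (abs_nonneg q) hq).comp_injective PNat.coe_injective
  have h1 : Summable fun n : ℕ+ => (n : ℝ) * |q| ^ (n : ℕ) := by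
    have h := summable_pow_mul_geometric_of_norm_lt_one (R := ℝ) 1 (r := |q|) (by simpa using hq)
    simpa [Function.comp_def] using h.comp_injective PNat.coe_injective
  have h2 := (h1.mul_of_nonneg h0 (fun _ => by positivity) (fun _ => by positivity)).add
    (h0.mul_of_nonneg h1 (fun _ => by positivity) (fun _ => by positivity))
  refine Summable.of_norm_bounded (h2.mul_right C) fun p => ?_
  have hpos : (0 : ℝ) ≤ (p.1 : ℝ) + (p.2 : ℝ) := by positivity
  rw [Real.norm_eq_abs, abs_mul, abs_mul, abs_pow, abs_of_nonneg hpos]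
  calc _ ≤ ((p.1 : ℝ) + (p.2 : ℝ)) * |q| ^ ((p.1 : ℕ) + (p.2 : ℕ)) * C := by
        gcongr
        exact hc p
    _ = _ := by ring

theorem one_sub_abs_le_abs_one_sub_pow {q : ℝ} (hq : |q| < 1) {n : ℕ} (hn : n ≠ 0) :
    1 - |q| ≤ |1 - q ^ n| := by
  have h1 : |q ^ n| ≤ |q| := by
    rw [abs_pow]
    exact pow_le_of_le_one (abs_nonneg q) hq.le hn
  have h2 := le_abs_self (q ^ n)
  have h3 := le_abs_self (1 - q ^ n)
  linarith

theorem one_sub_pow_ne_zero {q : ℝ} (hq : |q| < 1) {n : ℕ} (hn : n ≠ 0) : 1 - q ^ n ≠ 0 := by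
  have h := one_sub_abs_le_abs_one_sub_pow hq hn
  exact abs_pos.mp (by linarith)

theorem abs_inv_one_sub_pow_le {q : ℝ} (hq : |q| < 1) (n : ℕ+) :
    |(1 - q ^ (n : ℕ))⁻¹| ≤ (1 - |q|)⁻¹ := by
  rw [abs_inv]
  exact inv_anti₀ (by linarith) (one_sub_abs_le_abs_one_sub_pow hq n.ne_zero)

theorem PNat.tsum_ite_lt_const (n : ℕ+) (a : ℝ) :
    (∑' m : ℕ+, if (m : ℕ) < (n : ℕ) then a else 0) = ((n : ℝ) - 1) * a := by
  rw [tsum_eq_sum (s := Finset.Ico 1 n)]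
  · rw [Finset.sum_congr rfl (g := fun _ => a)]
    · have h1 : 1 ≤ (n : ℕ) := n.pos
      simp [Nat.cast_sub h1]
    · intro m hm
      exact if_pos (Finset.mem_Ico.mp hm).2
  · intro m hm
    refine if_neg fun h => hm (Finset.mem_Ico.mpr ⟨one_le, h⟩)

theorem weighted_double_sum (q : ℝ) (hq : |q| < 1) :
    (∑' i : ℕ+, ∑' j : ℕ+, ((i : ℝ) + (j : ℝ)) * q ^ ((i : ℕ) + (j : ℕ)) / ((1 - q ^ (i : ℕ)) * (1 - q ^ (j : ℕ)) * (1 - q ^ ((i : ℕ) + (j : ℕ)))))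
      = 2 * (∑' n : ℕ+, ∑' m : ℕ+, if (m : ℕ) < (n : ℕ) then (n : ℝ) * q ^ (n : ℕ) / ((1 - q ^ (n : ℕ)) ^ 2 * (1 - q ^ (m : ℕ))) else 0)
        - ∑' n : ℕ+, (n : ℝ) * ((n : ℝ) - 1) * q ^ (n : ℕ) / (1 - q ^ (n : ℕ)) ^ 2 := by
  have hu := abs_inv_one_sub_pow_le hq
  have hA : (0 : ℝ) ≤ (1 - |q|)⁻¹ := inv_nonneg.mpr (by linarith)
  set H : ℕ+ → ℕ+ → ℝ := fun m n =>
    (n : ℝ) * q ^ (n : ℕ) / ((1 - q ^ (n : ℕ)) ^ 2 * (1 - q ^ (m : ℕ))) with hH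
  set K : ℕ+ → ℝ := fun n => (n : ℝ) * q ^ (n : ℕ) / (1 - q ^ (n : ℕ)) ^ 2 with hK
  have sH : Summable fun p : ℕ+ × ℕ+ => H p.1 (p.1 + p.2) := by
    refine (summable_add_mul_pow_add_mul hq
      (fun p => (1 - q ^ ((p.1 + p.2 : ℕ+) : ℕ))⁻¹ ^ 2 * (1 - q ^ (p.1 : ℕ))⁻¹)
      ((1 - |q|)⁻¹ ^ 2 * (1 - |q|)⁻¹) fun p => ?_).congr fun p => ?_
    · rw [abs_mul, abs_pow]
      gcongr
      exacts [hu _, hu _]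
    · simp only [hH, PNat.add_coe, Nat.cast_add, div_eq_mul_inv, mul_inv, inv_pow]
  have sK : Summable fun p : ℕ+ × ℕ+ => K (p.1 + p.2) := by
    refine (summable_add_mul_pow_add_mul hq
      (fun p => (1 - q ^ ((p.1 + p.2 : ℕ+) : ℕ))⁻¹ ^ 2) ((1 - |q|)⁻¹ ^ 2) fun p => ?_).congr
      fun p => ?_
    · rw [abs_pow]
      gcongr
      exact hu _
    · simp only [hK, PNat.add_coe, Nat.cast_add, div_eq_mul_inv, inv_pow]
  have sH' : Summable fun p : ℕ+ × ℕ+ => H p.2 (p.1 + p.2) :=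
    ((Equiv.prodComm ℕ+ ℕ+).summable_iff.mpr sH).congr fun p => by
      simp [add_comm]
  have tH' : ∑' p : ℕ+ × ℕ+, H p.2 (p.1 + p.2) = ∑' p : ℕ+ × ℕ+, H p.1 (p.1 + p.2) := by
    rw [← (Equiv.prodComm ℕ+ ℕ+).tsum_eq]
    exact tsum_congr fun p => by simp [add_comm]
  have key : ∀ p : ℕ+ × ℕ+,
      ((p.1 : ℝ) + (p.2 : ℝ)) * q ^ ((p.1 : ℕ) + (p.2 : ℕ)) / ((1 - q ^ (p.1 : ℕ)) *
        (1 - q ^ (p.2 : ℕ)) * (1 - q ^ ((p.1 : ℕ) + (p.2 : ℕ))))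
      = H p.1 (p.1 + p.2) + H p.2 (p.1 + p.2) - K (p.1 + p.2) := by
    rintro ⟨i, j⟩
    have hi := one_sub_pow_ne_zero hq i.ne_zero
    have hj := one_sub_pow_ne_zero hq j.ne_zero
    have hij := one_sub_pow_ne_zero hq (i + j).ne_zero
    simp only [hH, hK, PNat.add_coe, Nat.cast_add] at hij ⊢
    rw [pow_add] at hij ⊢
    field_simp
    ring
  have sF := ((sH.add sH').sub sK).congr fun p => (key p).symm
  rw [← sF.tsum_prod, tsum_congr key, (sH.add sH').tsum_sub sK, sH.tsum_add sH', tH',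
    tsum_add_eq_tsum_lt H sH, tsum_add_eq_tsum_lt (fun _ n => K n) sK, ← two_mul]
  congr 1
  refine tsum_congr fun n => ?_
  rw [PNat.tsum_ite_lt_const]
  simp only [hK]
  ring
end

section
/- Let q be a real number with |q| < 1. Then ∑_{i,j,k ≥ 1} q^{i+j+k} / ((1-q^i)(1-q^j)(1-q^k)(1-q^{i+j+k})) = ∑_{n₁ > n₂ > n₃ ≥ 1} (q^{n₁} + 2 q^{n₁+n₂} + 2 q^{n₁+n₃} + q^{n₁+n₂+n₃}) / ((1-q^{n₁})^2 (1-q^{n₂}) (1-q^{n₃})). -/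
open scoped BigOperators

section FiniteIdentity

open Finset

variable {R : Type*} [CommRing R]

theorem sum_range_reflect_mul_cast (u : ℕ → R) (n : ℕ) :
    ∑ b ∈ range n, u (n - 1 - b) * (b : R) = ∑ b ∈ range n, ∑ a ∈ range b, u a := by
  rw [← sum_range_reflect]
  induction n with
  | zero => simp
  | succ n ih =>
    rw [sum_range_succ, sum_range_succ (fun b => ∑ a ∈ range b, u a), ← ih,
      ← sum_add_distrib]
    simp only [Nat.add_sub_cancel, Nat.sub_self, Nat.cast_zero, mul_zero, add_zero]
    refine sum_congr rfl fun k hk => ?_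
    obtain ⟨m, rfl⟩ := Nat.exists_eq_add_of_lt (mem_range.1 hk)
    have h₁ : k + m + 1 - (k + m + 1 - k) = k := by omega
    have h₂ : k + m + 1 - 1 - (k + m + 1 - 1 - k) = k := by omega
    have h₃ : k + m + 1 - k = m + 1 := by omega
    have h₄ : k + m + 1 - 1 - k = m := by omega
    rw [h₁, h₂, h₃, h₄]
    push_cast
    ring

theorem sum_range_one_add_add_reflect (u : ℕ → R) (n : ℕ) :
    ∑ a ∈ range n, (1 + u a + u (n - 1 - a)) = n + 2 * ∑ a ∈ range n, u a := by
  rw [sum_add_distrib, sum_add_distrib, sum_range_reflect u n]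
  simp
  ring

theorem sum_range_reflect_mul_sum {u : ℕ → R}
    (hu : ∀ i j, u i * u j = u (i + j + 1) * (1 + u i + u j)) (n : ℕ) :
    ∑ b ∈ range n, u (n - 1 - b) * ∑ a ∈ range b, u a =
      ∑ b ∈ range n, u b * (b + 2 * ∑ a ∈ range b, u a) := by
  rw [← sum_range_reflect]
  induction n with
  | zero => simp
  | succ n ih =>
    rw [sum_range_succ, sum_range_succ (fun b => u b * (b + 2 * ∑ a ∈ range b, u a)), ← ih,
      ← sum_range_one_add_add_reflect u n, mul_sum (range n) _ (u n), ← sum_add_distrib]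
    simp only [Nat.add_sub_cancel, Nat.sub_self, range_zero, sum_empty, mul_zero, add_zero]
    refine sum_congr rfl fun k hk => ?_
    obtain ⟨m, rfl⟩ := Nat.exists_eq_add_of_lt (mem_range.1 hk)
    have h₁ : k + m + 1 - (k + m + 1 - k) = k := by omega
    have h₂ : k + m + 1 - 1 - (k + m + 1 - 1 - k) = k := by omega
    have h₃ : k + m + 1 - k = m + 1 := by omega
    have h₄ : k + m + 1 - 1 - k = m := by omega
    rw [h₁, h₂, h₃, h₄, sum_range_succ, ← hu]
    ring

theorem sum_strict_triple_eq {u : ℕ → R}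
    (hu : ∀ i j, u i * u j = u (i + j + 1) * (1 + u i + u j)) (n : ℕ) :
    ∑ b ∈ range n, ∑ a ∈ range b, (1 + u b + u (n - 1 - b)) * (1 + u a + u (b - 1 - a)) =
      ∑ b ∈ range n, ∑ a ∈ range b, (1 + 3 * u a + 3 * u b + 6 * u a * u b) := by
  have hA := sum_range_reflect_mul_cast u n
  have hB := sum_range_reflect_mul_sum hu n
  have hL : ∀ b, ∑ a ∈ range b, (1 + u b + u (n - 1 - b)) * (1 + u a + u (b - 1 - a)) =
      b + u b * b + 2 * (∑ a ∈ range b, u a) + 2 * (u b * ∑ a ∈ range b, u a)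
        + u (n - 1 - b) * b + 2 * (u (n - 1 - b) * ∑ a ∈ range b, u a) := fun b => by
    rw [← mul_sum, sum_range_one_add_add_reflect]
    ring
  have hR : ∀ b, ∑ a ∈ range b, (1 + 3 * u a + 3 * u b + 6 * u a * u b) =
      b + 3 * (∑ a ∈ range b, u a) + 3 * (u b * b) + 6 * (u b * ∑ a ∈ range b, u a) :=
    fun b => by
      simp only [sum_add_distrib, ← mul_sum, ← sum_mul, sum_const, card_range, nsmul_eq_mul]
      ring
  have hB' : ∑ b ∈ range n, u b * (b + 2 * ∑ a ∈ range b, u a) =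
      ∑ b ∈ range n, u b * b + 2 * ∑ b ∈ range n, (u b * ∑ a ∈ range b, u a) := by
    rw [mul_sum, ← sum_add_distrib]
    exact sum_congr rfl fun b _ => by ring
  simp only [hL, hR, sum_add_distrib, ← mul_sum, hA, hB, hB']
  ring

end FiniteIdentity

section Summation

open Finset

theorem one_sub_pow_succ_ne_zero {q : ℝ} (hq : |q| < 1) (n : ℕ) : 1 - q ^ (n + 1) ≠ 0 := by
  intro h
  have h₁ : |q| ^ (n + 1) < 1 := pow_lt_one₀ (abs_nonneg q) hq n.succ_ne_zero
  rw [← abs_pow, ← sub_eq_zero.1 h, abs_one] at h₁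
  exact lt_irrefl _ h₁

theorem abs_inv_one_sub_pow_succ_le {q : ℝ} (hq : |q| < 1) (n : ℕ) :
    |(1 - q ^ (n + 1))⁻¹| ≤ (1 - |q|)⁻¹ := by
  rw [abs_inv]
  refine inv_anti₀ (by linarith) ?_
  have h₁ : |q| ^ (n + 1) ≤ |q| := pow_le_of_le_one (abs_nonneg q) hq.le n.succ_ne_zero
  have h₂ := abs_sub_abs_le_abs_sub 1 (q ^ (n + 1))
  rw [abs_one, abs_pow] at h₂
  linarith

/-- The summand `q^{i+j+k} / ((1-q^i)(1-q^j)(1-q^k)(1-q^{i+j+k}))`, with each index shifted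
down by one. -/
noncomputable def compositionTerm (q : ℝ) (i j k : ℕ) : ℝ :=
  q ^ ((i + 1) + (j + 1) + (k + 1)) / ((1 - q ^ (i + 1)) * (1 - q ^ (j + 1)) * (1 - q ^ (k + 1)) *
    (1 - q ^ ((i + 1) + (j + 1) + (k + 1))))

theorem summable_compositionTerm {q : ℝ} (hq : |q| < 1) :
    Summable fun p : ℕ × ℕ × ℕ => compositionTerm q p.1 p.2.1 p.2.2 := by
  have hg : Summable fun n : ℕ => |q| ^ n := summable_geometric_of_lt_one (abs_nonneg q) hq
  have h0 : (0 : ℕ → ℝ) ≤ fun n => |q| ^ n := fun n => by positivity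
  have h3 := hg.mul_of_nonneg (hg.mul_of_nonneg hg h0 h0) h0 fun p => by
    simp only [Pi.zero_apply]; positivity
  refine (h3.mul_left (|q| ^ 3 * (1 - |q|)⁻¹ ^ 4)).of_norm_bounded fun p => ?_
  obtain ⟨i, j, k⟩ := p
  have hi := abs_inv_one_sub_pow_succ_le hq i
  have hj := abs_inv_one_sub_pow_succ_le hq j
  have hk := abs_inv_one_sub_pow_succ_le hq k
  have hs := abs_inv_one_sub_pow_succ_le hq (i + 1 + (j + 1) + k)
  have hc : 0 ≤ (1 - |q|)⁻¹ := inv_nonneg.2 (by linarith)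
  calc ‖compositionTerm q i j k‖
      = |q| ^ (i + 1 + (j + 1) + (k + 1)) * (|(1 - q ^ (i + 1))⁻¹| * |(1 - q ^ (j + 1))⁻¹| *
          |(1 - q ^ (k + 1))⁻¹| * |(1 - q ^ (i + 1 + (j + 1) + k + 1))⁻¹|) := by
        rw [compositionTerm, Real.norm_eq_abs, div_eq_mul_inv, mul_inv, mul_inv, mul_inv]
        simp only [abs_mul, abs_pow]
        rfl
    _ ≤ |q| ^ (i + 1 + (j + 1) + (k + 1)) *
          ((1 - |q|)⁻¹ * (1 - |q|)⁻¹ * (1 - |q|)⁻¹ * (1 - |q|)⁻¹) := by gcongr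
    _ = |q| ^ 3 * (1 - |q|)⁻¹ ^ 4 * (|q| ^ i * (|q| ^ j * |q| ^ k)) := by ring

theorem tsum_ite_lt_eq_sum (F : ℕ → ℕ → ℝ) (n : ℕ) :
    ∑' b : ℕ, ∑' a : ℕ, (if a < b ∧ b < n then F a b else 0) =
      ∑ b ∈ range n, ∑ a ∈ range b, F a b := by
  rw [tsum_eq_sum (s := range n)]
  · refine sum_congr rfl fun b hb => ?_
    rw [tsum_eq_sum (s := range b)]
    · exact sum_congr rfl fun a ha => if_pos ⟨mem_range.1 ha, mem_range.1 hb⟩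
    · exact fun a ha => if_neg fun h => ha (mem_range.2 h.1)
  · intro b hb
    have h : ∀ a, (if a < b ∧ b < n then F a b else 0) = 0 :=
      fun a => if_neg fun h => hb (mem_range.2 h.2)
    simp [h]

/-- Summing over `(i, j, k)` amounts to summing over the partial sums of the triple. -/
theorem tsum_triple_eq_tsum_sum_range {G : ℕ → ℕ → ℕ → ℝ}
    (hG : Summable fun p : ℕ × ℕ × ℕ => G p.1 p.2.1 p.2.2) :
    ∑' i, ∑' j, ∑' k, G i j k =
      ∑' n, ∑ b ∈ range n, ∑ a ∈ range b, G a (b - 1 - a) (n - 1 - b) := by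
  let e : ℕ × ℕ × ℕ → ℕ × ℕ × ℕ := fun p => (p.1 + p.2.1 + p.2.2 + 2, p.1 + p.2.1 + 1, p.1)
  let H : ℕ × ℕ × ℕ → ℝ := fun r =>
    if r.2.2 < r.2.1 ∧ r.2.1 < r.1 then G r.2.2 (r.2.1 - 1 - r.2.2) (r.1 - 1 - r.2.1) else 0
  have he : Function.Injective e := by
    rintro ⟨i, j, k⟩ ⟨i', j', k'⟩ h
    simp only [e, Prod.mk.injEq] at h ⊢
    omega
  have hHe : ∀ p, H (e p) = G p.1 p.2.1 p.2.2 := by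
    rintro ⟨i, j, k⟩
    have h₁ : i < i + j + 1 ∧ i + j + 1 < i + j + k + 2 := by omega
    have h₂ : i + j + 1 - 1 - i = j := by omega
    have h₃ : i + j + k + 2 - 1 - (i + j + 1) = k := by omega
    simp only [H, e, if_pos h₁, h₂, h₃]
  have hrange : ∀ r ∉ Set.range e, H r = 0 := by
    rintro ⟨n, b, a⟩ hr
    refine if_neg fun h => hr ⟨(a, b - 1 - a, n - 1 - b), ?_⟩
    simp only at h
    simp only [e, Prod.mk.injEq, and_true]
    omega
  have hH : Summable H := by
    rw [← he.summable_iff hrange]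
    exact hG.congr fun p => (hHe p).symm
  calc ∑' i, ∑' j, ∑' k, G i j k
      = ∑' p : ℕ × ℕ × ℕ, G p.1 p.2.1 p.2.2 := by
        rw [hG.tsum_prod]
        exact tsum_congr fun i => ((hG.prod_factor i).tsum_prod).symm
    _ = ∑' p, H (e p) := tsum_congr fun p => (hHe p).symm
    _ = ∑' r, H r := he.tsum_eq (Function.support_subset_iff'.2 hrange)
    _ = ∑' n, ∑' b, ∑' a, H (n, b, a) := by
        rw [hH.tsum_prod]
        exact tsum_congr fun n => (hH.prod_factor n).tsum_prod
    _ = _ := tsum_congr fun n => tsum_ite_lt_eq_sum (fun a b => G a (b - 1 - a) (n - 1 - b)) n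

theorem sum_compositionTerm_eq {q : ℝ} (hq : |q| < 1) (n : ℕ) :
    ∑ b ∈ range n, ∑ a ∈ range b, compositionTerm q a (b - 1 - a) (n - 1 - b) =
      ∑ b ∈ range n, ∑ a ∈ range b,
        (q ^ (n + 1) + 2 * q ^ ((n + 1) + (b + 1)) + 2 * q ^ ((n + 1) + (a + 1))
          + q ^ ((n + 1) + (b + 1) + (a + 1))) /
        ((1 - q ^ (n + 1)) ^ 2 * (1 - q ^ (b + 1)) * (1 - q ^ (a + 1))) := by
  have hne := one_sub_pow_succ_ne_zero hq
  let u : ℕ → ℝ := fun m => q ^ (m + 1) / (1 - q ^ (m + 1))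
  have hu : ∀ i j, u i * u j = u (i + j + 1) * (1 + u i + u j) := fun i j => by
    have h₁ := hne i
    have h₂ := hne j
    have h₃ := hne (i + j + 1)
    have h₄ : q ^ (i + j + 1 + 1) = q ^ (i + 1) * q ^ (j + 1) := by ring
    simp only [u]
    rw [h₄] at h₃ ⊢
    generalize q ^ (i + 1) = x at *
    generalize q ^ (j + 1) = y at *
    field_simp
    ring
  have hsum := congrArg (q ^ (n + 1) / (1 - q ^ (n + 1)) ^ 2 * ·) (sum_strict_triple_eq hu n)
  simp only [mul_sum] at hsum
  convert hsum using 1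
  · refine sum_congr rfl fun b hb => sum_congr rfl fun a ha => ?_
    obtain ⟨j, rfl⟩ := Nat.exists_eq_add_of_lt (mem_range.1 ha)
    obtain ⟨k, rfl⟩ := Nat.exists_eq_add_of_lt (mem_range.1 hb)
    have e₁ : a + j + 1 - 1 - a = j := by omega
    have e₂ : a + j + 1 + k + 1 - 1 - (a + j + 1) = k := by omega
    have e₃ : q ^ (a + j + 1 + 1) = q ^ (a + 1) * q ^ (j + 1) := by ring
    have e₄ : q ^ (a + j + 1 + k + 1 + 1) = q ^ (a + 1) * q ^ (j + 1) * q ^ (k + 1) := by ring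
    have e₅ : q ^ (a + 1 + (j + 1) + (k + 1)) = q ^ (a + 1) * q ^ (j + 1) * q ^ (k + 1) := by ring
    have h₁ := hne a
    have h₂ := hne j
    have h₃ := hne k
    have h₄ := hne (a + j + 1)
    have h₅ := hne (a + j + 1 + k + 1)
    simp only [u, compositionTerm]
    rw [e₁, e₂, e₃, e₄, e₅]
    rw [e₃] at h₄
    rw [e₄] at h₅
    generalize q ^ (a + 1) = x at *
    generalize q ^ (j + 1) = y at *
    generalize q ^ (k + 1) = z at *
    field_simp
    ring
  · refine sum_congr rfl fun b _ => sum_congr rfl fun a _ => ?_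
    have h₁ := hne a
    have h₂ := hne b
    have h₃ := hne n
    simp only [u, pow_add q (n + 1), pow_add q (n + 1 + (b + 1))]
    generalize q ^ (a + 1) = x at *
    generalize q ^ (b + 1) = y at *
    generalize q ^ (n + 1) = z at *
    field_simp
    ring

theorem tsum_pnat_triple_eq (F : ℕ → ℕ → ℕ → ℝ) :
    ∑' i : ℕ+, ∑' j : ℕ+, ∑' k : ℕ+, F i j k =
      ∑' i : ℕ, ∑' j : ℕ, ∑' k : ℕ, F (i + 1) (j + 1) (k + 1) := by
  rw [tsum_pnat_eq_tsum_succ (f := fun i => ∑' j : ℕ+, ∑' k : ℕ+, F i j k)]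
  refine tsum_congr fun i => ?_
  rw [tsum_pnat_eq_tsum_succ (f := fun j => ∑' k : ℕ+, F (i + 1) j k)]
  exact tsum_congr fun j => tsum_pnat_eq_tsum_succ (f := fun k => F (i + 1) (j + 1) k)

end Summation

theorem T_eq_strict_triple (q : ℝ) (hq : |q| < 1) :
    (∑' i : ℕ+, ∑' j : ℕ+, ∑' k : ℕ+, q ^ ((i : ℕ) + (j : ℕ) + (k : ℕ)) / ((1 - q ^ (i : ℕ)) * (1 - q ^ (j : ℕ)) * (1 - q ^ (k : ℕ)) * (1 - q ^ ((i : ℕ) + (j : ℕ) + (k : ℕ))))) = ∑' n₁ : ℕ+, ∑' n₂ : ℕ+, ∑' n₃ : ℕ+, if (n₃ : ℕ) < (n₂ : ℕ) ∧ (n₂ : ℕ) < (n₁ : ℕ) then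
        (q ^ (n₁ : ℕ) + 2 * q ^ ((n₁ : ℕ) + (n₂ : ℕ)) + 2 * q ^ ((n₁ : ℕ) + (n₃ : ℕ))
          + q ^ ((n₁ : ℕ) + (n₂ : ℕ) + (n₃ : ℕ))) /
        ((1 - q ^ (n₁ : ℕ)) ^ 2 * (1 - q ^ (n₂ : ℕ)) * (1 - q ^ (n₃ : ℕ))) else 0 := by
  rw [tsum_pnat_triple_eq fun i j k => q ^ (i + j + k) /
      ((1 - q ^ i) * (1 - q ^ j) * (1 - q ^ k) * (1 - q ^ (i + j + k))),
    tsum_pnat_triple_eq fun n b a => if a < b ∧ b < n then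
      (q ^ n + 2 * q ^ (n + b) + 2 * q ^ (n + a) + q ^ (n + b + a)) /
        ((1 - q ^ n) ^ 2 * (1 - q ^ b) * (1 - q ^ a)) else 0]
  refine (tsum_triple_eq_tsum_sum_range (summable_compositionTerm hq)).trans
    (tsum_congr fun n => ?_)
  simp only [add_lt_add_iff_right]
  rw [sum_compositionTerm_eq hq, ← tsum_ite_lt_eq_sum]
end

section
/- Let q be a real number with |q| < 1. Then (1/12) ∑_{n ≥ 1} (n-1)(2n-1) q^n/(1-q^n)^2 + (1/4) ∑_{i ≥ 1, j ≥ 1} (i+j-1) q^{i+j} / ((1-q^i)(1-q^j)(1-q^{i+j})) + (1/2) T(q) - (1/4) S(q) = (13/12) Z(4) - (1/3) Z(2)^2 - (1/4) Z(3) + (1/4) Z(2), where T(q) = ∑_{i,j,k ≥ 1} q^{i+j+k} / ((1-q^i)(1-q^j)(1-q^k)(1-q^{i+j+k})) and S(q) = ∑_{i,j,k,ℓ ≥ 1, i+j = k+ℓ} q^{i+j} / ((1-q^i)(1-q^j)(1-q^k)(1-q^ℓ)). (This is the coefficient of ⟨K_X², α⟩ in the reduced series (q;q)_∞^{χ(X)}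 · F₂^α(q).) -/
open scoped BigOperators

section

open Finset

namespace LambertSeries

/-! ### Finite sums -/

theorem sum_Ico_sub (f : ℕ → ℕ → ℝ) (n : ℕ) :
    ∑ m ∈ Ico 1 n, f (n - m) m = ∑ m ∈ Ico 1 n, f m (n - m) := by
  refine sum_nbij' (fun m => n - m) (fun m => n - m) ?_ ?_ ?_ ?_ ?_ <;>
    intro m hm <;> rw [mem_Ico] at hm
  · exact mem_Ico.2 (by omega)
  · exact mem_Ico.2 (by omega)
  · omega
  · omega
  · rw [show n - (n - m) = m by omega]

theorem sum_Ico_one (n : ℕ) : ∑ _m ∈ Ico 1 (n + 1), (1 : ℝ) = n := by simp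

theorem sum_Ico_cast (n : ℕ) : ∑ m ∈ Ico 1 (n + 1), (m : ℝ) = n * (n + 1) / 2 := by
  induction n with
  | zero => simp
  | succ n ih => rw [sum_Ico_succ_top (by omega), ih]; push_cast; ring

/-! ### Summing over pairs of positive integers -/

theorem tsum_pnat_pnat {F : ℕ → ℕ → ℝ} (hl : ∀ j, F 0 j = 0) (hr : ∀ i, F i 0 = 0) :
    ∑' i : ℕ+, ∑' j : ℕ+, F i j = ∑' i : ℕ, ∑' j : ℕ, F i j := by
  rw [← tsum_pnat_eq_tsum_of_eq_zero (f := fun i => ∑' j : ℕ, F i j) (by simp [hl])]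
  exact tsum_congr fun i => tsum_pnat_eq_tsum_of_eq_zero (hr i)

/-- Grouping a double series by the sum of the two indices. -/
theorem hasSum_sum_Ico_sub {F : ℕ → ℕ → ℝ} (hl : ∀ j, F 0 j = 0) (hr : ∀ i, F i 0 = 0)
    (hF : Summable fun p : ℕ × ℕ => F p.1 p.2) :
    HasSum (fun n => ∑ m ∈ Ico 1 n, F (n - m) m) (∑' i : ℕ, ∑' j : ℕ, F i j) := by
  have h := hF.hasSum
  rw [hF.tsum_prod, ← HasAntidiagonal.sigmaAntidiagonalEquivProd.hasSum_iff] at h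
  convert h.sigma fun n => hasSum_fintype _ using 1
  ext n
  rw [sum_Ico_sub F n, Finset.univ_eq_attach]
  trans ∑ p ∈ antidiagonal n, F p.1 p.2
  · rw [Nat.sum_antidiagonal_eq_sum_range_succ F, range_eq_Ico]
    refine sum_subset (fun m hm => ?_) fun m hm hm' => ?_
    · rw [mem_Ico] at hm ⊢
      omega
    · rw [mem_Ico] at hm hm'
      rcases Nat.eq_zero_or_pos m with rfl | hm0
      · exact hl _
      · rw [show n - m = 0 by omega, hr]
  · exact (sum_attach _ fun p : ℕ × ℕ => F p.1 p.2).symm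

/-- Grouping a double series by the larger of the two indices. -/
theorem hasSum_diag_add_sum_Ico {F : ℕ → ℕ → ℝ} (hl : ∀ j, F 0 j = 0) (hr : ∀ i, F i 0 = 0)
    (hF : Summable fun p : ℕ × ℕ => F p.1 p.2) :
    HasSum (fun n => F n n + ∑ m ∈ Ico 1 n, (F m n + F n m)) (∑' i : ℕ, ∑' j : ℕ, F i j) := by
  have hrow : ∀ G : ℕ → ℕ → ℝ, (∀ i, G i 0 = 0) → Summable (fun p : ℕ × ℕ => G p.1 p.2) →
      HasSum (fun n => ∑ m ∈ Ico 1 n, G n m)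
        (∑' p : ℕ × ℕ, {p : ℕ × ℕ | p.2 < p.1}.indicator (fun p => G p.1 p.2) p) := by
    intro G hG hs
    refine (hs.indicator _).hasSum.prod_fiberwise fun n => ?_
    rw [show ∑ m ∈ Ico 1 n, G n m = ∑ m ∈ Ico 1 n,
        {p : ℕ × ℕ | p.2 < p.1}.indicator (fun p => G p.1 p.2) (n, m) from
      sum_congr rfl fun m hm => by simp [(mem_Ico.1 hm).2]]
    refine hasSum_sum_of_ne_finset_zero fun m hm => ?_
    rcases Nat.eq_zero_or_pos m with rfl | hm0
    · by_cases h : 0 < n <;> simp [Set.indicator, hG]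
    · have : ¬ m < n := fun h => hm (mem_Ico.2 ⟨hm0, h⟩)
      simp [this]
  have hdiag : HasSum (fun n => F n n)
      (∑' p : ℕ × ℕ, {p : ℕ × ℕ | p.2 = p.1}.indicator (fun p => F p.1 p.2) p) := by
    refine (hF.indicator _).hasSum.prod_fiberwise fun n => ?_
    convert hasSum_single n fun m hm => ?_ using 1
    · simp
    · simp [hm]
  have hcol : HasSum (fun n => ∑ m ∈ Ico 1 n, F m n)
      (∑' p : ℕ × ℕ, {p : ℕ × ℕ | p.1 < p.2}.indicator (fun p => F p.1 p.2) p) := by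
    rw [← (Equiv.prodComm ℕ ℕ).tsum_eq]
    exact hrow (fun i j => F j i) hl ((Equiv.prodComm ℕ ℕ).summable_iff.2 hF)
  convert hdiag.add (hcol.add (hrow F hr hF)) using 1
  · simp only [sum_add_distrib]
  · rw [← Summable.tsum_add (hF.indicator _) (hF.indicator _),
      ← Summable.tsum_add (hF.indicator _) ((hF.indicator _).add (hF.indicator _)),
      ← hF.tsum_prod (f := fun p : ℕ × ℕ => F p.1 p.2)]
    refine tsum_congr fun p => ?_
    rcases lt_trichotomy p.1 p.2 with h | h | h
    · simp [Set.indicator, h, h.ne', h.not_gt]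
    · simp [Set.indicator, h]
    · simp [Set.indicator, h, h.ne, h.not_gt]

/-- The difference of the two groupings of a double series. -/
theorem hasSum_diag_add_sub {F : ℕ → ℕ → ℝ} (hl : ∀ j, F 0 j = 0) (hr : ∀ i, F i 0 = 0)
    (hF : Summable fun p : ℕ × ℕ => F p.1 p.2) :
    HasSum (fun n => F n n + ∑ m ∈ Ico 1 n, (F m n + F n m - F (n - m) m)) 0 := by
  have h := (hasSum_diag_add_sum_Ico hl hr hF).sub (hasSum_sum_Ico_sub hl hr hF)
  rw [sub_self] at h
  refine h.congr_fun fun n => ?_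
  rw [sum_sub_distrib]
  ring

/-! ### Rapidly decaying sequences -/

/-- A sequence that stays absolutely summable after multiplication by any power of the index. -/
def RapidDecay (u : ℕ → ℝ) : Prop := ∀ k : ℕ, Summable fun n : ℕ => ((n : ℝ) + 1) ^ k * |u n|

theorem RapidDecay.mul {u w : ℕ → ℝ} (hu : RapidDecay u) (M : ℝ) (d : ℕ)
    (hw : ∀ n, |w n| ≤ M * ((n : ℝ) + 1) ^ d) : RapidDecay fun n => u n * w n := by
  intro k
  refine Summable.of_nonneg_of_le (fun n => by positivity) (fun n => ?_) ((hu (k + d)).mul_left M)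
  calc ((n : ℝ) + 1) ^ k * |u n * w n| = ((n : ℝ) + 1) ^ k * |u n| * |w n| := by
        rw [abs_mul, mul_assoc]
    _ ≤ ((n : ℝ) + 1) ^ k * |u n| * (M * ((n : ℝ) + 1) ^ d) := by gcongr; exact hw n
    _ = _ := by ring

theorem RapidDecay.summable {u : ℕ → ℝ} (hu : RapidDecay u) : Summable u :=
  Summable.of_abs (by simpa using hu 0)

theorem RapidDecay.summable_prod {u v : ℕ → ℝ} {w : ℕ → ℕ → ℝ} (hu : RapidDecay u)
    (hv : RapidDecay v) (M : ℝ) (d : ℕ)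
    (hw : ∀ i j, |w i j| ≤ M * (((i : ℝ) + 1) ^ d * ((j : ℝ) + 1) ^ d)) :
    Summable fun p : ℕ × ℕ => u p.1 * v p.2 * w p.1 p.2 := by
  refine Summable.of_norm_bounded (((hu d).mul_of_nonneg (hv d) (fun n => by positivity)
    fun n => by positivity).mul_left M) fun p => ?_
  rw [Real.norm_eq_abs, abs_mul, abs_mul]
  calc |u p.1| * |v p.2| * |w p.1 p.2|
      ≤ |u p.1| * |v p.2| * (M * (((p.1 : ℝ) + 1) ^ d * ((p.2 : ℝ) + 1) ^ d)) := by
        gcongr; exact hw _ _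
    _ = _ := by ring

theorem RapidDecay.summable_mul {u v : ℕ → ℝ} (hu : RapidDecay u) (hv : RapidDecay v) :
    Summable fun p : ℕ × ℕ => u p.1 * v p.2 := by
  simpa using hu.summable_prod hv (w := fun _ _ => 1) 1 0 (by simp)

/-! ### Lambert terms -/

/-- The Lambert term `qⁿ/(1-qⁿ)`, which has the value `0` at `n = 0`. -/
noncomputable def lambert (q : ℝ) (n : ℕ) : ℝ := q ^ n / (1 - q ^ n)

/-- The partial sum of the Lambert terms over `1 ≤ m < n`. -/
noncomputable def lambertSum (q : ℝ) (n : ℕ) : ℝ := ∑ m ∈ Ico 1 n, lambert q m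

@[simp]
theorem lambert_zero (q : ℝ) : lambert q 0 = 0 := by simp [lambert]

theorem one_sub_pow_ne_zero {q : ℝ} (hq : |q| < 1) {n : ℕ} (hn : n ≠ 0) : 1 - q ^ n ≠ 0 := by
  intro h
  have h1 : |q| ^ n = 1 := by rw [← abs_pow, ← sub_eq_zero.1 h, abs_one]
  exact (pow_lt_one₀ (abs_nonneg q) hq hn).ne h1

theorem one_div_one_sub_pow {q : ℝ} (hq : |q| < 1) {n : ℕ} (hn : n ≠ 0) :
    1 / (1 - q ^ n) = 1 + lambert q n := by
  have := one_sub_pow_ne_zero hq hn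
  rw [lambert]
  field_simp
  ring

theorem lambert_mul_lambert {q : ℝ} (hq : |q| < 1) {i j : ℕ} (hi : i ≠ 0) (hj : j ≠ 0) :
    lambert q i * lambert q j = lambert q (i + j) * (1 + lambert q i + lambert q j) := by
  have h1 := one_sub_pow_ne_zero hq hi
  have h2 := one_sub_pow_ne_zero hq hj
  have h3 := one_sub_pow_ne_zero hq (n := i + j) (by omega)
  simp only [lambert]
  field_simp
  rw [pow_add] at *
  ring

theorem abs_lambert_le {q : ℝ} (hq : |q| < 1) (n : ℕ) :
    |lambert q n| ≤ (1 - |q|)⁻¹ * |q| ^ n := by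
  have h0 : 0 < 1 - |q| := sub_pos.2 hq
  rcases eq_or_ne n 0 with rfl | hn
  · simpa using h0.le
  have h1 : 1 - |q| ≤ |1 - q ^ n| := by
    calc 1 - |q| ≤ 1 - |q| ^ n := by
          gcongr
          exact pow_le_of_le_one (abs_nonneg q) hq.le hn
      _ ≤ |1 - q ^ n| := by
          rw [← abs_pow]
          simpa using abs_sub_abs_le_abs_sub 1 (q ^ n)
  rw [lambert, abs_div, abs_pow, div_eq_inv_mul]
  gcongr

theorem abs_lambert_le_const {q : ℝ} (hq : |q| < 1) (n : ℕ) : |lambert q n| ≤ (1 - |q|)⁻¹ := by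
  have h0 : 0 < 1 - |q| := sub_pos.2 hq
  exact (abs_lambert_le hq n).trans
    (mul_le_of_le_one_right (by positivity) (pow_le_one₀ (abs_nonneg q) hq.le))

theorem abs_lambertSum_le {q : ℝ} (hq : |q| < 1) (n : ℕ) :
    |lambertSum q n| ≤ (1 - |q|)⁻¹ * ((n : ℝ) + 1) ^ 1 := by
  have h0 : 0 < 1 - |q| := sub_pos.2 hq
  calc |lambertSum q n| ≤ ∑ m ∈ Ico 1 n, |lambert q m| := abs_sum_le_sum_abs _ _
    _ ≤ ∑ m ∈ Ico 1 n, (1 - |q|)⁻¹ := sum_le_sum fun m _ => abs_lambert_le_const hq m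
    _ = ((n - 1 : ℕ) : ℝ) * (1 - |q|)⁻¹ := by simp
    _ ≤ ((n : ℝ) + 1) * (1 - |q|)⁻¹ := by
        gcongr
        exact_mod_cast (by omega : n - 1 ≤ n + 1)
    _ = _ := by ring

theorem abs_one_add_mul_lambert_le {q : ℝ} (hq : |q| < 1) (c : ℝ) (n : ℕ) :
    |1 + c * lambert q n| ≤ (1 + |c| * (1 - |q|)⁻¹) * ((n : ℝ) + 1) ^ 0 := by
  calc |1 + c * lambert q n| ≤ |1| + |c * lambert q n| := abs_add_le _ _
    _ ≤ 1 + |c| * (1 - |q|)⁻¹ := by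
        rw [abs_one, abs_mul]
        gcongr
        exact abs_lambert_le_const hq n
    _ = _ := by simp

theorem abs_cast_sub_one_add_le {q : ℝ} (hq : |q| < 1) (n : ℕ) :
    |(n : ℝ) - 1 + 2 * lambertSum q n| ≤ (1 + 2 * (1 - |q|)⁻¹) * ((n : ℝ) + 1) ^ 1 := by
  calc |(n : ℝ) - 1 + 2 * lambertSum q n| ≤ |(n : ℝ) - 1| + |2 * lambertSum q n| := abs_add_le _ _
    _ ≤ ((n : ℝ) + 1) + 2 * ((1 - |q|)⁻¹ * ((n : ℝ) + 1) ^ 1) := by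
        rw [abs_mul, abs_two]
        gcongr
        · exact abs_le.2 ⟨by linarith [n.cast_nonneg (α := ℝ)], by linarith⟩
        · exact abs_lambertSum_le hq n
    _ = _ := by ring

theorem rapidDecay_lambert {q : ℝ} (hq : |q| < 1) : RapidDecay (lambert q) := by
  intro k
  have h : Summable fun n : ℕ => ((n : ℝ) + 1) ^ k * |q| ^ n := by
    simp only [add_pow, sum_mul, one_pow, mul_one]
    refine summable_sum fun i _ => ?_
    refine ((summable_pow_mul_geometric_of_norm_lt_one i (r := |q|) (by simpa)).mul_left
      (k.choose i : ℝ)).congr fun n => ?_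
    ring
  refine Summable.of_nonneg_of_le (fun n => by positivity) (fun n => ?_)
    (h.mul_left (1 - |q|)⁻¹)
  calc ((n : ℝ) + 1) ^ k * |lambert q n|
      ≤ ((n : ℝ) + 1) ^ k * ((1 - |q|)⁻¹ * |q| ^ n) := by gcongr; exact abs_lambert_le hq n
    _ = _ := by ring

theorem rapidDecay_lambert_mul_one_add {q : ℝ} (hq : |q| < 1) :
    RapidDecay fun n => lambert q n * (1 + lambert q n) :=
  (rapidDecay_lambert hq).mul _ 0 (by simpa using abs_one_add_mul_lambert_le hq 1)

/-! ### Finite sums of Lambert terms -/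

theorem sum_Ico_lambert_sub (q : ℝ) (n : ℕ) : ∑ m ∈ Ico 1 n, lambert q (n - m) = lambertSum q n :=
  sum_Ico_sub (fun i _ => lambert q i) n

theorem sum_Ico_cast_mul_sub (f : ℕ → ℝ) (n : ℕ) :
    ∑ m ∈ Ico 1 n, (m : ℝ) * f (n - m) =
      n * ∑ m ∈ Ico 1 n, f m - ∑ m ∈ Ico 1 n, (m : ℝ) * f m := by
  rw [sum_Ico_sub (fun i m => (m : ℝ) * f i) n, mul_sum, ← sum_sub_distrib]
  refine sum_congr rfl fun m hm => ?_
  rw [Nat.cast_sub (mem_Ico.1 hm).2.le]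
  ring

theorem lambertSum_succ (q : ℝ) {n : ℕ} (hn : n ≠ 0) :
    lambertSum q (n + 1) = lambertSum q n + lambert q n :=
  sum_Ico_succ_top (by omega) _

theorem sum_Ico_lambertSum (q : ℝ) (n : ℕ) :
    ∑ m ∈ Ico 1 (n + 1), lambertSum q m =
      n * lambertSum q (n + 1) - ∑ m ∈ Ico 1 (n + 1), (m : ℝ) * lambert q m := by
  induction n with
  | zero => simp
  | succ n ih =>
    rw [sum_Ico_succ_top (by omega), ih, sum_Ico_succ_top (b := n + 1) (by omega),
      lambertSum_succ q (n := n + 1) (by omega)]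
    push_cast
    ring

theorem sum_Ico_lambert_mul_lambertSum (q : ℝ) (n : ℕ) :
    ∑ m ∈ Ico 1 n, lambert q m * lambertSum q m =
      (lambertSum q n ^ 2 - ∑ m ∈ Ico 1 n, lambert q m ^ 2) / 2 := by
  induction n with
  | zero => simp [lambertSum]
  | succ n ih =>
    rcases eq_or_ne n 0 with rfl | hn
    · simp [lambertSum]
    · rw [sum_Ico_succ_top (by omega), ih, sum_Ico_succ_top (by omega), lambertSum_succ q hn]
      ring

theorem sum_Ico_lambert_sub_mul_lambert {q : ℝ} (hq : |q| < 1) (n : ℕ) :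
    ∑ m ∈ Ico 1 n, lambert q (n - m) * lambert q m =
      lambert q n * ((n : ℝ) - 1 + 2 * lambertSum q n) := by
  rcases n with _ | n
  · simp
  calc ∑ m ∈ Ico 1 (n + 1), lambert q (n + 1 - m) * lambert q m
      = ∑ m ∈ Ico 1 (n + 1), lambert q (n + 1) * (1 + lambert q (n + 1 - m) + lambert q m) := by
        refine sum_congr rfl fun m hm => ?_
        rw [mem_Ico] at hm
        rw [lambert_mul_lambert hq (by omega) (by omega), Nat.sub_add_cancel hm.2.le]
    _ = _ := by
        rw [← mul_sum, sum_add_distrib, sum_add_distrib, sum_Ico_one, sum_Ico_lambert_sub,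
          ← lambertSum]
        push_cast
        ring

theorem sum_Ico_one_add_lambert {q : ℝ} (hq : |q| < 1) {n : ℕ} (hn : n ≠ 0) :
    ∑ m ∈ Ico 1 n, (1 + lambert q (n - m)) * (1 + lambert q m) =
      (1 + lambert q n) * ((n : ℝ) - 1 + 2 * lambertSum q n) := by
  obtain ⟨n, rfl⟩ := Nat.exists_eq_succ_of_ne_zero hn
  have h (m : ℕ) : (1 + lambert q (n + 1 - m)) * (1 + lambert q m) =
      1 + lambert q (n + 1 - m) + lambert q m + lambert q (n + 1 - m) * lambert q m := by ring
  simp only [Nat.succ_eq_add_one, h]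
  rw [sum_add_distrib, sum_add_distrib, sum_add_distrib, sum_Ico_one, sum_Ico_lambert_sub,
    sum_Ico_lambert_sub_mul_lambert hq, ← lambertSum]
  push_cast
  ring

theorem sum_Ico_lambert_sub_mul_lambertSum {q : ℝ} (hq : |q| < 1) (n : ℕ) :
    ∑ m ∈ Ico 1 n, lambert q (n - m) * lambertSum q m =
      ∑ m ∈ Ico 1 n, lambert q m * ((m : ℝ) - 1 + 2 * lambertSum q m) := by
  induction n with
  | zero => simp
  | succ n ih =>
    rcases eq_or_ne n 0 with rfl | hn
    · simp
    · rw [sum_Ico_succ_top (by omega)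
          fun m => lambert q m * ((m : ℝ) - 1 + 2 * lambertSum q m), ← ih, ← sum_Ico_lambert_sub_mul_lambert hq,
        ← sum_add_distrib, sum_eq_sum_Ico_succ_bot (by omega), ← sum_Ico_add' _ 1 n 1]
      simp only [lambertSum, Ico_self, sum_empty, mul_zero, zero_add]
      refine sum_congr rfl fun m hm => ?_
      rw [sum_Ico_succ_top (mem_Ico.1 hm).1, Nat.add_sub_add_right]
      ring

theorem sum_Ico_lambert_mul_sub_one_add (q : ℝ) (n : ℕ) :
    ∑ m ∈ Ico 1 n, lambert q m * ((m : ℝ) - 1 + 2 * lambertSum q m) =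
      ∑ m ∈ Ico 1 n, (m : ℝ) * lambert q m - lambertSum q n + lambertSum q n ^ 2
        - ∑ m ∈ Ico 1 n, lambert q m ^ 2 := by
  have h (m : ℕ) : lambert q m * ((m : ℝ) - 1 + 2 * lambertSum q m) =
      m * lambert q m - lambert q m + 2 * (lambert q m * lambertSum q m) := by ring
  simp only [h]
  rw [sum_add_distrib, sum_sub_distrib, ← mul_sum, sum_Ico_lambert_mul_lambertSum, ← lambertSum]
  ring

theorem sum_Ico_lambert_triple {q : ℝ} (hq : |q| < 1) (n : ℕ) :
    ∑ m ∈ Ico 1 n, lambert q (n - m) * (lambert q m * ((m : ℝ) - 1 + 2 * lambertSum q m)) =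
      lambert q n * (((n : ℝ) - 1) * (n - 2) / 2 + 3 * (n - 2) * lambertSum q n
        + 3 * lambertSum q n ^ 2 - 3 * ∑ m ∈ Ico 1 n, lambert q m ^ 2) := by
  rcases n with _ | n
  · simp
  calc _ = ∑ m ∈ Ico 1 (n + 1), lambert q (n + 1) * ((m : ℝ) - 1 + 2 * lambertSum q m
        + m * lambert q (n + 1 - m) - lambert q (n + 1 - m)
        + 2 * (lambert q (n + 1 - m) * lambertSum q m)
        + lambert q m * ((m : ℝ) - 1 + 2 * lambertSum q m)) := by
        refine sum_congr rfl fun m hm => ?_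
        rw [mem_Ico] at hm
        rw [← mul_assoc, lambert_mul_lambert hq (by omega) (by omega),
          Nat.sub_add_cancel hm.2.le]
        ring
    _ = _ := by
        rw [← mul_sum, sum_add_distrib, sum_add_distrib, sum_sub_distrib, sum_add_distrib,
          sum_add_distrib, sum_sub_distrib, sum_Ico_one, sum_Ico_cast, ← mul_sum, ← mul_sum,
          sum_Ico_lambertSum, sum_Ico_lambert_sub_mul_lambertSum hq,
          sum_Ico_lambert_mul_sub_one_add, sum_Ico_cast_mul_sub, sum_Ico_lambert_sub,
          ← lambertSum]
        push_cast
        ring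

/-! ### Relations among the double series -/

/-- The difference of the two groupings of `∑ F i j`, computed from a function `g` describing the
contribution of the pair `(i, j)` in terms of `i + j` and `j`. -/
theorem hasSum_zero_of_relation {F : ℕ → ℕ → ℝ} {r : ℕ → ℝ} (hl : ∀ j, F 0 j = 0)
    (hr : ∀ i, F i 0 = 0) (hF : Summable fun p : ℕ × ℕ => F p.1 p.2) (h0 : r 0 = 0)
    (g : ℕ → ℕ → ℝ)
    (hg : ∀ i j, i ≠ 0 → j ≠ 0 → F j (i + j) + F (i + j) j - F i j = g (i + j) j)
    (h : ∀ n, F (n + 1) (n + 1) + ∑ m ∈ Ico 1 (n + 1), g (n + 1) m = r (n + 1)) :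
    HasSum r 0 := by
  refine (hasSum_diag_add_sub hl hr hF).congr_fun fun n => ?_
  rcases n with _ | n
  · simp [h0, hl]
  rw [← h]
  congr 1
  refine sum_congr rfl fun m hm => ?_
  rw [mem_Ico] at hm
  have := hg (n + 1 - m) m (by omega) (by omega)
  rw [Nat.sub_add_cancel hm.2.le] at this
  exact this.symm

theorem lambert_mul_deriv {q : ℝ} (hq : |q| < 1) {i j : ℕ} (hi : i ≠ 0) (hj : j ≠ 0) :
    lambert q i * (lambert q j * (1 + lambert q j)) =
      lambert q (i + j) * (1 + lambert q (i + j)) * (1 + lambert q i + lambert q j)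
        + lambert q (i + j) * (lambert q j * (1 + lambert q j)) := by
  linear_combination (1 + lambert q j + lambert q (i + j)) * lambert_mul_lambert hq hi hj

theorem hasSum_relation_one_two {q : ℝ} (hq : |q| < 1) :
    HasSum (fun n : ℕ => lambert q n * (1 + lambert q n)
      * (lambert q n - (n - 1) - lambertSum q n)) 0 := by
  refine hasSum_zero_of_relation
    (F := fun i j => lambert q i * (lambert q j * (1 + lambert q j))) (by simp) (by simp)
    ((rapidDecay_lambert hq).summable_mul (rapidDecay_lambert_mul_one_add hq)) (by simp)
    (fun n m => -(lambert q n * (1 + lambert q n)) * (1 + lambert q (n - m)))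
    (fun i j hi hj => ?_) (fun n => ?_)
  · rw [Nat.add_sub_cancel]
    linear_combination -lambert_mul_deriv hq hi hj
  · rw [← mul_sum, sum_add_distrib, sum_Ico_one, sum_Ico_lambert_sub]
    push_cast
    ring

theorem hasSum_relation_weighted {q : ℝ} (hq : |q| < 1) :
    HasSum (fun n : ℕ => lambert q n * (1 + lambert q n)
      * (n * (lambert q n - ((n : ℝ) - 1) / 2))) 0 := by
  refine hasSum_zero_of_relation
    (F := fun i j => lambert q i * (lambert q j * (1 + lambert q j) * j)) (by simp) (by simp)
    ((rapidDecay_lambert hq).summable_mul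
      ((rapidDecay_lambert_mul_one_add hq).mul (w := fun n => (n : ℝ)) 1 1 fun n => ?_)) (by simp)
    (fun n m => lambert q n * (1 + lambert q n)
      * (n * lambert q m - m - m * lambert q m - m * lambert q (n - m)))
    (fun i j hi hj => ?_) (fun n => ?_)
  · simp
  · rw [Nat.add_sub_cancel]
    push_cast
    linear_combination (-j : ℝ) * lambert_mul_deriv hq hi hj
  · rw [← mul_sum, sum_sub_distrib, sum_sub_distrib, sum_sub_distrib, ← mul_sum, sum_Ico_cast,
      sum_Ico_cast_mul_sub]
    push_cast
    ring

theorem hasSum_relation_one_three {q : ℝ} (hq : |q| < 1) :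
    HasSum (fun n : ℕ => lambert q n * (1 + lambert q n)
      * ((1 + 2 * lambert q n) * (lambert q n - (n - 1) - lambertSum q n)
        - 2 * ∑ m ∈ Ico 1 n, lambert q m * (1 + lambert q m))) 0 := by
  refine hasSum_zero_of_relation
    (F := fun i j => lambert q i * (lambert q j * (1 + lambert q j) * (1 + 2 * lambert q j)))
    (by simp) (by simp)
    ((rapidDecay_lambert hq).summable_mul
      ((rapidDecay_lambert_mul_one_add hq).mul _ 0 (abs_one_add_mul_lambert_le hq 2))) (by simp)
    (fun n m => -(lambert q n * (1 + lambert q n))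
      * ((1 + 2 * lambert q n) * (1 + lambert q (n - m))
        + 2 * (lambert q m * (1 + lambert q m))))
    (fun i j hi hj => ?_) (fun n => ?_)
  · rw [Nat.add_sub_cancel]
    linear_combination -(1 + 2 * lambert q j) * lambert_mul_deriv hq hi hj
      - 2 * (lambert q (i + j) * (1 + lambert q (i + j))) * lambert_mul_lambert hq hi hj
  · rw [← mul_sum, sum_add_distrib, ← mul_sum, ← mul_sum, sum_add_distrib, sum_Ico_one,
      sum_Ico_lambert_sub]
    push_cast
    ring

theorem hasSum_relation_two_two {q : ℝ} (hq : |q| < 1) :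
    HasSum (fun n : ℕ => lambert q n * (1 + lambert q n)
      * (lambert q n * (1 + lambert q n)
        - (1 + 2 * lambert q n) * (n - 1 + 2 * lambertSum q n))) 0 := by
  have hb := rapidDecay_lambert_mul_one_add hq
  have hs := hb.summable_mul hb
  refine hasSum_zero_of_relation
    (F := fun i j => lambert q i * (1 + lambert q i) * (lambert q j * (1 + lambert q j)))
    (by simp) (by simp) hs (by simp)
    (fun n m => lambert q n * (1 + lambert q n)
      * (lambert q m * (1 + lambert q m) - lambert q (n - m) * (1 + lambert q (n - m))
        - (1 + 2 * lambert q n) * (1 + lambert q (n - m) + lambert q m)))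
    (fun i j hi hj => ?_) (fun n => ?_)
  · rw [Nat.add_sub_cancel]
    linear_combination -(1 + lambert q i + lambert q (i + j)) * lambert_mul_deriv hq hi hj
      - (lambert q (i + j) * (1 + lambert q (i + j))) * lambert_mul_lambert hq hi hj
  · rw [← mul_sum, sum_sub_distrib, sum_sub_distrib, ← mul_sum, sum_add_distrib, sum_add_distrib,
      sum_Ico_one, sum_Ico_lambert_sub, ← lambertSum,
      sum_Ico_sub (fun i _ => lambert q i * (1 + lambert q i))]
    push_cast
    ring

theorem hasSum_relation_one_two_one {q : ℝ} (hq : |q| < 1) :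
    HasSum (fun n : ℕ => lambert q n * (1 + lambert q n)
      * (lambert q n * lambertSum q n - (n - 2) * lambertSum q n - lambertSum q n ^ 2 / 2
        + 3 / 2 * ∑ m ∈ Ico 1 n, lambert q m ^ 2)) 0 := by
  have hs := (rapidDecay_lambert hq).summable_mul
    ((rapidDecay_lambert_mul_one_add hq).mul _ 1 (abs_lambertSum_le hq))
  refine hasSum_zero_of_relation
    (F := fun i j => lambert q i * (lambert q j * (1 + lambert q j) * lambertSum q j))
    (by simp) (by simp) hs (by simp)
    (fun n m => lambert q n * (1 + lambert q n)
      * (lambertSum q n * lambert q m - lambertSum q m - lambert q (n - m) * lambertSum q m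
        - lambert q m * lambertSum q m))
    (fun i j hi hj => ?_) (fun n => ?_)
  · rw [Nat.add_sub_cancel]
    linear_combination -lambertSum q j * lambert_mul_deriv hq hi hj
  · rw [← mul_sum, sum_sub_distrib, sum_sub_distrib, sum_sub_distrib, ← mul_sum, ← lambertSum,
      sum_Ico_lambertSum, sum_Ico_lambert_sub_mul_lambertSum hq, sum_Ico_lambert_mul_sub_one_add,
      sum_Ico_lambert_mul_lambertSum]
    push_cast
    ring

/-! ### The series in the statement -/

theorem hasSum_pnat_of_lambert {q : ℝ} (hq : |q| < 1) {f : ℕ → ℝ} {w : ℕ → ℝ} (h0 : f 0 = 0)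
    (M : ℝ) (d : ℕ) (hw : ∀ n, |w n| ≤ M * ((n : ℝ) + 1) ^ d)
    (h : ∀ n, n ≠ 0 → f n = lambert q n * (1 + lambert q n) * w n) :
    HasSum (fun n => lambert q n * (1 + lambert q n) * w n) (∑' n : ℕ+, f n) := by
  rw [tsum_pnat_eq_tsum_of_eq_zero h0, show f = fun n => lambert q n * (1 + lambert q n) * w n by
    ext n
    rcases eq_or_ne n 0 with rfl | hn
    · simp [h0]
    · exact h n hn]
  exact ((rapidDecay_lambert_mul_one_add hq).mul M d hw).summable.hasSum

theorem hasSum_Z2 {q : ℝ} (hq : |q| < 1) :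
    HasSum (fun n => lambert q n * (1 + lambert q n) * 1) (Z2 q) := by
  refine hasSum_pnat_of_lambert hq (f := fun n => q ^ n / (1 - q ^ n) ^ 2) (w := fun _ => 1)
    (by simp) 1 0 (by simp) fun n hn => ?_
  rw [← one_div_one_sub_pow hq hn, lambert]
  simp only [div_eq_mul_inv, ← inv_pow]
  ring

theorem hasSum_Z3 {q : ℝ} (hq : |q| < 1) :
    HasSum (fun n => lambert q n * (1 + lambert q n) * (1 + 2 * lambert q n)) (Z3 q) := by
  refine hasSum_pnat_of_lambert hq (f := fun n => q ^ n * (q ^ n + 1) / (1 - q ^ n) ^ 3)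
    (by simp) _ 0 (abs_one_add_mul_lambert_le hq 2) fun n hn => ?_
  have := one_sub_pow_ne_zero hq hn
  rw [lambert]
  field_simp
  ring

theorem hasSum_Z4 {q : ℝ} (hq : |q| < 1) :
    HasSum (fun n => lambert q n * (1 + lambert q n) * (lambert q n * (1 + lambert q n)))
      (Z4 q) := by
  refine hasSum_pnat_of_lambert hq (f := fun n => q ^ (2 * n) / (1 - q ^ n) ^ 4)
    (by simp) ((1 - |q|)⁻¹ * (1 + |1| * (1 - |q|)⁻¹)) 0 (fun n => ?_) fun n hn => ?_
  · rw [abs_mul, mul_assoc]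
    have h0 : 0 < 1 - |q| := sub_pos.2 hq
    gcongr
    · exact abs_lambert_le_const hq n
    · simpa using abs_one_add_mul_lambert_le hq 1 n
  · rw [← one_div_one_sub_pow hq hn, lambert]
    simp only [div_eq_mul_inv, ← inv_pow]
    ring

theorem hasSum_Z2_sq {q : ℝ} (hq : |q| < 1) :
    HasSum (fun n => lambert q n * (1 + lambert q n) * (lambert q n * (1 + lambert q n)
      + 2 * ∑ m ∈ Ico 1 n, lambert q m * (1 + lambert q m))) (Z2 q ^ 2) := by
  have hb := rapidDecay_lambert_mul_one_add hq
  have hs := hb.summable_mul hb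
  have h := hasSum_diag_add_sum_Ico
    (F := fun i j => lambert q i * (1 + lambert q i) * (lambert q j * (1 + lambert q j)))
    (by simp) (by simp) hs
  have hZ := (hasSum_Z2 hq).tsum_eq
  simp only [mul_one] at hZ
  simp only [tsum_mul_left, tsum_mul_right, hZ, ← sq] at h
  refine h.congr_fun fun n => ?_
  rw [sum_add_distrib, ← sum_mul, ← mul_sum]
  ring

theorem hasSum_weighted_Z2 {q : ℝ} (hq : |q| < 1) :
    HasSum (fun n : ℕ => lambert q n * (1 + lambert q n) * (((n : ℝ) - 1) * (2 * n - 1)))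
      (∑' n : ℕ+, ((n : ℝ) - 1) * (2 * (n : ℝ) - 1) * q ^ (n : ℕ) / (1 - q ^ (n : ℕ)) ^ 2) := by
  refine hasSum_pnat_of_lambert hq (w := fun n => ((n : ℝ) - 1) * (2 * n - 1))
    (f := fun n : ℕ => ((n : ℝ) - 1) * (2 * (n : ℝ) - 1) * q ^ n / (1 - q ^ n) ^ 2)
    (by simp) 2 2 (fun n => ?_) fun n hn => ?_
  · have := n.cast_nonneg (α := ℝ)
    exact abs_le.2 ⟨by nlinarith, by nlinarith⟩
  · rw [← one_div_one_sub_pow hq hn, lambert]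
    simp only [div_eq_mul_inv, ← inv_pow]
    ring

/-- Grouping a double series of products of Lambert terms by the sum of the two indices. -/
theorem hasSum_lambert_conv {q : ℝ} (hq : |q| < 1) {f : ℕ → ℕ → ℝ} {w : ℕ → ℝ}
    (hl : ∀ j, f 0 j = 0) (hr : ∀ i, f i 0 = 0) (M : ℝ)
    (hw : ∀ n, |w n| ≤ M * ((n : ℝ) + 1) ^ 1)
    (h : ∀ i j, i ≠ 0 → j ≠ 0 → f i j = lambert q i * lambert q j * w (i + j)) :
    HasSum (fun n : ℕ => lambert q n * (n - 1 + 2 * lambertSum q n) * w n)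
      (∑' i : ℕ+, ∑' j : ℕ+, f i j) := by
  rw [tsum_pnat_pnat hl hr]
  have hf : f = fun i j => lambert q i * lambert q j * w (i + j) := by
    ext i j
    rcases eq_or_ne i 0 with rfl | hi
    · simp [hl]
    rcases eq_or_ne j 0 with rfl | hj
    · simp [hr]
    exact h i j hi hj
  have ha := rapidDecay_lambert hq
  have hM : 0 ≤ M := by simpa using (abs_nonneg _).trans (hw 0)
  have hF : Summable fun p : ℕ × ℕ => f p.1 p.2 := by
    rw [hf]
    refine ha.summable_prod ha (w := fun i j => w (i + j)) M 1 fun i j => (hw _).trans ?_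
    gcongr
    push_cast
    nlinarith [mul_nonneg (i.cast_nonneg (α := ℝ)) (j.cast_nonneg (α := ℝ))]
  refine (hasSum_sum_Ico_sub hl hr hF).congr_fun fun n => ?_
  rw [← sum_Ico_lambert_sub_mul_lambert hq, sum_mul, hf]
  refine sum_congr rfl fun m hm => ?_
  dsimp only
  rw [Nat.sub_add_cancel (mem_Ico.1 hm).2.le]

theorem hasSum_double {q : ℝ} (hq : |q| < 1) :
    HasSum (fun n : ℕ => lambert q n * (1 + lambert q n)
      * ((n - 1) * (n - 1 + 2 * lambertSum q n)))
      (∑' i : ℕ+, ∑' j : ℕ+, ((i : ℝ) + (j : ℝ) - 1) * q ^ ((i : ℕ) + (j : ℕ)) /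
        ((1 - q ^ (i : ℕ)) * (1 - q ^ (j : ℕ)) * (1 - q ^ ((i : ℕ) + (j : ℕ))))) := by
  refine (hasSum_lambert_conv hq (w := fun n => (1 + 1 * lambert q n) * (n - 1))
    (f := fun i j : ℕ => ((i : ℝ) + (j : ℝ) - 1) * q ^ (i + j) /
      ((1 - q ^ i) * (1 - q ^ j) * (1 - q ^ (i + j)))) (by simp) (by simp)
    (1 + |1| * (1 - |q|)⁻¹) (fun n => ?_) fun i j hi hj => ?_).congr_fun fun n => ?_
  · have hn := n.cast_nonneg (α := ℝ)
    have h0 : 0 < 1 - |q| := sub_pos.2 hq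
    rw [abs_mul]
    gcongr
    · simpa only [pow_zero, mul_one] using abs_one_add_mul_lambert_le hq 1 n
    · exact abs_le.2 ⟨by linarith, by linarith⟩
  · rw [one_mul, ← one_div_one_sub_pow hq (by omega), lambert, lambert, pow_add]
    simp only [div_eq_mul_inv, mul_inv]
    push_cast
    ring
  · ring

theorem tsum_pnat_pnat_ite {g : ℕ → ℕ → ℝ} (n : ℕ) :
    (∑' k : ℕ+, ∑' l : ℕ+, if n = (k : ℕ) + (l : ℕ) then g k l else 0) =
      ∑ m ∈ Ico 1 n, g (n - m) m := by
  rw [sum_Ico_sub g n]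
  have hk : ∀ k : ℕ+, (∑' l : ℕ+, if n = (k : ℕ) + (l : ℕ) then g k l else 0) =
      (Ico 1 n : Set ℕ).indicator (fun m => g m (n - m)) k := by
    intro k
    by_cases h : (k : ℕ) < n
    · rw [Set.indicator_of_mem (by simpa using ⟨k.pos, h⟩),
        tsum_eq_single ⟨n - k, Nat.sub_pos_of_lt h⟩ fun l hl => if_neg fun e => hl ?_]
      · simp [Nat.add_sub_cancel' h.le]
      · exact PNat.eq (by simp [e])
    · rw [Set.indicator_of_notMem (by simp [h])]
      exact (tsum_congr fun l => if_neg (by have := l.pos; omega)).trans tsum_zero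
  rw [tsum_congr hk, tsum_pnat_eq_tsum_of_eq_zero
    (f := (Ico 1 n : Set ℕ).indicator fun m => g m (n - m)) (by simp),
    tsum_eq_sum (s := Ico 1 n) fun m hm => Set.indicator_of_notMem (by simpa using hm) _]
  exact sum_congr rfl fun m hm => Set.indicator_of_mem (by simpa using hm) _

theorem hasSum_quadruple {q : ℝ} (hq : |q| < 1) :
    HasSum (fun n : ℕ => lambert q n * (1 + lambert q n) * (n - 1 + 2 * lambertSum q n) ^ 2)
      (∑' i : ℕ+, ∑' j : ℕ+, ∑' k : ℕ+, ∑' l : ℕ+,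
        if (i : ℕ) + (j : ℕ) = (k : ℕ) + (l : ℕ) then q ^ ((i : ℕ) + (j : ℕ)) /
          ((1 - q ^ (i : ℕ)) * (1 - q ^ (j : ℕ)) * (1 - q ^ (k : ℕ)) * (1 - q ^ (l : ℕ)))
        else 0) := by
  have hkl (i j : ℕ+) := tsum_pnat_pnat_ite (g := fun k l => q ^ ((i : ℕ) + (j : ℕ)) /
    ((1 - q ^ (i : ℕ)) * (1 - q ^ (j : ℕ)) * (1 - q ^ k) * (1 - q ^ l))) (i + j)
  simp only [hkl]
  refine (hasSum_lambert_conv hq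
    (w := fun n => (1 + 1 * lambert q n) * (n - 1 + 2 * lambertSum q n))
    (f := fun i j : ℕ => ∑ m ∈ Ico 1 (i + j), q ^ (i + j) /
      ((1 - q ^ i) * (1 - q ^ j) * (1 - q ^ (i + j - m)) * (1 - q ^ m))) (by simp) (by simp)
    ((1 + |1| * (1 - |q|)⁻¹) * (1 + 2 * (1 - |q|)⁻¹))
    (fun n => ?_) fun i j hi hj => ?_).congr_fun fun n => ?_
  · have h0 : 0 < 1 - |q| := sub_pos.2 hq
    rw [abs_mul, mul_assoc]
    gcongr
    · simpa only [pow_zero, mul_one] using abs_one_add_mul_lambert_le hq 1 n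
    · exact abs_cast_sub_one_add_le hq n
  · rw [one_mul, ← sum_Ico_one_add_lambert hq (by omega), mul_sum]
    refine sum_congr rfl fun m hm => ?_
    rw [mem_Ico] at hm
    rw [← one_div_one_sub_pow hq (by omega), ← one_div_one_sub_pow hq (by omega), lambert,
      lambert, pow_add]
    simp only [div_eq_mul_inv, mul_inv]
    ring
  · ring

theorem hasSum_triple {q : ℝ} (hq : |q| < 1) :
    HasSum (fun n : ℕ => lambert q n * (1 + lambert q n)
      * (((n : ℝ) - 1) * (n - 2) / 2 + 3 * (n - 2) * lambertSum q n
        + 3 * lambertSum q n ^ 2 - 3 * ∑ m ∈ Ico 1 n, lambert q m ^ 2))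
      (∑' i : ℕ+, ∑' j : ℕ+, ∑' k : ℕ+, q ^ ((i : ℕ) + (j : ℕ) + (k : ℕ)) /
        ((1 - q ^ (i : ℕ)) * (1 - q ^ (j : ℕ)) * (1 - q ^ (k : ℕ)) *
          (1 - q ^ ((i : ℕ) + (j : ℕ) + (k : ℕ))))) := by
  have h0 : 0 < 1 - |q| := sub_pos.2 hq
  have hbound (n : ℕ) : |1 + 1 * lambert q n| ≤ 1 + |1| * (1 - |q|)⁻¹ := by
    simpa only [pow_zero, mul_one] using abs_one_add_mul_lambert_le hq 1 n
  have ha := rapidDecay_lambert hq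
  have hH : RapidDecay fun m => lambert q m * ((m : ℝ) - 1 + 2 * lambertSum q m) :=
    ha.mul _ 1 (abs_cast_sub_one_add_le hq)
  have hF := ha.summable_prod hH (w := fun i m => 1 + 1 * lambert q (i + m)) _ 0
    (fun i m => by simpa only [pow_zero, mul_one] using hbound (i + m))
  have hinner (i : ℕ+) : (∑' j : ℕ+, ∑' k : ℕ+, q ^ ((i : ℕ) + (j : ℕ) + (k : ℕ)) /
      ((1 - q ^ (i : ℕ)) * (1 - q ^ (j : ℕ)) * (1 - q ^ (k : ℕ)) *
        (1 - q ^ ((i : ℕ) + (j : ℕ) + (k : ℕ))))) =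
      ∑' m : ℕ, lambert q i * (lambert q m * ((m : ℝ) - 1 + 2 * lambertSum q m))
        * (1 + 1 * lambert q (i + m)) := by
    refine HasSum.tsum_eq (HasSum.congr_fun (hasSum_lambert_conv hq
      (w := fun n => lambert q i * (1 + 1 * lambert q (i + n)))
      (f := fun j k : ℕ => q ^ ((i : ℕ) + j + k) /
        ((1 - q ^ (i : ℕ)) * (1 - q ^ j) * (1 - q ^ k) * (1 - q ^ ((i : ℕ) + j + k))))
      (by simp) (by simp) ((1 - |q|)⁻¹ * (1 + |1| * (1 - |q|)⁻¹))
      (fun n => ?_) fun j k hj hk => ?_) fun n => ?_) |>.symm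
    · rw [abs_mul]
      calc _ ≤ (1 - |q|)⁻¹ * (1 + |1| * (1 - |q|)⁻¹) := by
            gcongr
            · exact abs_lambert_le_const hq i
            · exact hbound _
        _ ≤ _ := le_mul_of_one_le_right (by positivity) (by simp)
    · rw [one_mul, ← one_div_one_sub_pow hq (by omega), lambert, lambert, lambert, pow_add,
        pow_add, pow_add, pow_add]
      simp only [div_eq_mul_inv, mul_inv]
      ring
    · ring
  rw [tsum_congr hinner, tsum_pnat_eq_tsum_of_eq_zero (f := fun i => ∑' m : ℕ, lambert q i *
    (lambert q m * ((m : ℝ) - 1 + 2 * lambertSum q m)) * (1 + 1 * lambert q (i + m))) (by simp)]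
  refine (hasSum_sum_Ico_sub (F := fun i m => lambert q i *
    (lambert q m * ((m : ℝ) - 1 + 2 * lambertSum q m)) * (1 + 1 * lambert q (i + m)))
    (by simp) (by simp) hF).congr_fun fun n => ?_
  rw [mul_right_comm, ← sum_Ico_lambert_triple hq, sum_mul]
  refine sum_congr rfl fun m hm => ?_
  rw [Nat.sub_add_cancel (mem_Ico.1 hm).2.le, one_mul]

end LambertSeries

end

open LambertSeries in
theorem KX2_coefficient (q : ℝ) (hq : |q| < 1) :
    1 / 12 * (∑' n : ℕ+, ((n : ℝ) - 1) * (2 * (n : ℝ) - 1) * q ^ (n : ℕ) / (1 - q ^ (n : ℕ)) ^ 2)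
      + 1 / 4 * (∑' i : ℕ+, ∑' j : ℕ+, ((i : ℝ) + (j : ℝ) - 1) * q ^ ((i : ℕ) + (j : ℕ)) / ((1 - q ^ (i : ℕ)) * (1 - q ^ (j : ℕ)) * (1 - q ^ ((i : ℕ) + (j : ℕ)))))
      + 1 / 2 * (∑' i : ℕ+, ∑' j : ℕ+, ∑' k : ℕ+, q ^ ((i : ℕ) + (j : ℕ) + (k : ℕ)) / ((1 - q ^ (i : ℕ)) * (1 - q ^ (j : ℕ)) * (1 - q ^ (k : ℕ)) * (1 - q ^ ((i : ℕ) + (j : ℕ) + (k : ℕ))))) - 1 / 4 * (∑' i : ℕ+, ∑' j : ℕ+, ∑' k : ℕ+, ∑' l : ℕ+, if (i : ℕ) + (j : ℕ) = (k : ℕ) + (l : ℕ) then q ^ ((i : ℕ) + (j : ℕ)) / ((1 - q ^ (i : ℕ)) * (1 - q ^ (j : ℕ)) * (1 - q ^ (k : ℕ)) * (1 - q ^ (l : ℕ))) else 0)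
      = 13 / 12 * Z4 q - 1 / 3 * (Z2 q) ^ 2 - 1 / 4 * Z3 q + 1 / 4 * Z2 q := by
  have h1 := (hasSum_relation_one_two hq).mul_left 12
  have h2 := (hasSum_relation_weighted hq).mul_left (-10)
  have h3 := (hasSum_relation_one_three hq).mul_left (-4)
  have h4 := (hasSum_relation_two_two hq).mul_left (-1)
  have h5 := (hasSum_relation_one_two_one hq).mul_left (-12)
  have hrel := (((h1.add h2).add h3).add h4).add h5
  have hA := hasSum_weighted_Z2 hq
  have hC := (hasSum_double hq).mul_left 3
  have hT := (hasSum_triple hq).mul_left 6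
  have hS := (hasSum_quadruple hq).mul_left 3
  have hZ := ((((hasSum_Z4 hq).mul_left 13).sub ((hasSum_Z2_sq hq).mul_left 4)).sub
    ((hasSum_Z3 hq).mul_left 3)).add ((hasSum_Z2 hq).mul_left 3)
  have key := (((hA.add hC).add hT).sub hS).sub hZ |>.unique (hrel.congr_fun fun n => ?_)
  · linear_combination key / 12
  · have hp : ∑ m ∈ Finset.Ico 1 n, lambert q m * (1 + lambert q m) =
        lambertSum q n + ∑ m ∈ Finset.Ico 1 n, lambert q m ^ 2 := by
      rw [lambertSum, ← Finset.sum_add_distrib]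
      exact Finset.sum_congr rfl fun m _ => by ring
    rw [hp]
    ring
end
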